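/- arXiv:1702.06266 — 4 statements merged into one kernel-verified Lean document; each statement's English description precedes it below -/
import Mathlib

section
/- Let S be a semilattice with infinite breadth. Then there exist a semilattice T, a surjective semilattice homomorphism from S onto T, and an injective semilattice homomorphism into T from at least one of T_max, T_min, T_ort; that is, some homomorphic image of S contains an isomorphic copy of T_max, T_min, or T_ort. -/
open Set Filter
open scoped Classical

variable {Ω : Type*}

/-- A union-closed set system (concrete semilattice) on `Ω`. -/
def UnionClosed (S : Set (Set Ω)) : Prop := ∀ x ∈ S, ∀ y ∈ S, x ∪ y ∈ S

/-- A finite collection of subsets of `Ω` is incompressible if no proper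
subcollection has the same union. -/
def Incompressible (F : Finset (Set Ω)) : Prop :=
  ∀ F' ⊂ F, ⋃₀ (↑F' : Set (Set Ω)) ≠ ⋃₀ (↑F : Set (Set Ω))

/-- `S` has infinite breadth: incompressible subcollections of every size. -/
def InfiniteBreadth (S : Set (Set Ω)) : Prop :=
  ∀ n : ℕ, ∃ F : Finset (Set Ω), ↑F ⊆ S ∧ F.card = n ∧ Incompressible F

/-- `S` has finite breadth. -/
def FiniteBreadth (S : Set (Set Ω)) : Prop :=
  ∃ N : ℕ, ∀ F : Finset (Set Ω), ↑F ⊆ S → Incompressible F → F.card ≤ N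

/-- `S` has breadth at most `m`. -/
def BreadthLE (S : Set (Set Ω)) (m : ℕ) : Prop :=
  ∀ F : Finset (Set Ω), ↑F ⊆ S → Incompressible F → F.card ≤ m

/-- `S ⊓ a = { x ∩ a : x ∈ S }`. -/
def proj (S : Set (Set Ω)) (a : Set Ω) : Set (Set Ω) := (fun x => x ∩ a) '' S

/-- `S ⊖ a = { x \ a : x ∈ S }`. -/
def ominus (S : Set (Set Ω)) (a : Set Ω) : Set (Set Ω) := (fun x => x \ a) '' S

/-- `S^{−Γ} = { x ∈ S : x ∩ Γ = ∅ }`. -/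
def avoid (S : Set (Set Ω)) (Γ : Set Ω) : Set (Set Ω) := {x ∈ S | x ∩ Γ = ∅}

/-- A spread: pairwise disjoint nonempty finite sets with sizes tending to infinity. -/
def IsSpread (E : ℕ → Set Ω) : Prop :=
  (∀ n, (E n).Finite) ∧ (∀ n, (E n).Nonempty) ∧
  (∀ m n, m ≠ n → Disjoint (E m) (E n)) ∧
  Tendsto (fun n => (E n).ncard) atTop atTop

/-- The join of a spread. -/
def sjoin (E : ℕ → Set Ω) : Set Ω := ⋃ n, E n

/-- The set system `T_max(ℰ)`. -/
def Tmax (E : ℕ → Set Ω) : Set (Set Ω) :=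
  {x | ∃ n, ∃ a : Set Ω, a ⊆ E n ∧ a.Nonempty ∧ x = (⋃ k < n, E k) ∪ a}

/-- The set system `T_min(ℰ)`. -/
def Tmin (E : ℕ → Set Ω) : Set (Set Ω) :=
  {x | ∃ n, ∃ a : Set Ω, a ⊆ E n ∧ a.Nonempty ∧ x = a ∪ ⋃ k > n, E k}

/-- The set system `T_ort(ℰ)`. -/
def Tort (E : ℕ → Set Ω) : Set (Set Ω) :=
  {x | ∃ n, ∃ a : Set Ω, a ⊆ E n ∧ a.Nonempty ∧
        x = (⋃ k < n, E k) ∪ a ∪ ⋃ k > n, E k}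

/-- A refinement of a spread. -/
def Refines (F E : ℕ → Set Ω) : Prop :=
  IsSpread F ∧ ∃ g : ℕ → ℕ, Function.Injective g ∧ ∀ j, F j ⊆ E (g j)

/-- The sequence `a` shatters the spread `E`. -/
def Shatters (a : ℕ → Set Ω) (E : ℕ → Set Ω) : Prop :=
  ∀ (m : ℕ) (y : ℕ → Set Ω), (∀ j < m, y j = a j ∨ y j = (a j)ᶜ) →
    Tendsto (fun n => (E n ∩ ⋂ j < m, y j).ncard) atTop atTop

/-- A finite partition of `Ω`. -/
def IsPartitionC (C : Finset (Set Ω)) : Prop :=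
  (∀ c ∈ C, ∀ d ∈ C, c ≠ d → Disjoint c d) ∧ ⋃₀ (↑C : Set (Set Ω)) = univ

/-- `C` colours the spread `E`. -/
def Colours (C : Finset (Set Ω)) (E : ℕ → Set Ω) : Prop :=
  ∀ c ∈ C, Tendsto (fun n => (c ∩ E n).ncard) atTop atTop

/-- The colouring `C` of the spread `E` is `S`-decisive. -/
def Decisive (S : Set (Set Ω)) (C : Finset (Set Ω)) (E : ℕ → Set Ω) : Prop :=
  ∃ c₀ ∈ C, ∀ x ∈ S, ∃ B : ℕ, ∀ n,
    (x ∩ c₀ ∩ E n).ncard ≤ B ∨ ∃ c ∈ C, (xᶜ ∩ c ∩ E n).ncard ≤ B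

/-- `F` halves `D` with respect to `(E n)_{n ∈ N}`. -/
def Halves (F D : Set Ω) (E : ℕ → Set Ω) (N : Set ℕ) : Prop :=
  Tendsto (fun n => (D ∩ F ∩ E n).ncard) (atTop ⊓ 𝓟 N) atTop ∧
  Tendsto (fun n => ((D \ F) ∩ E n).ncard) (atTop ⊓ 𝓟 N) atTop

/-- `Ew` is a witness of incompressibility for the collection `F`. -/
def IsWitness (F : Finset (Set Ω)) (Ew : Set Ω) : Prop :=
  ∃ w : Set Ω → Ω, (∀ x ∈ F, w x ∈ x ∧ ∀ y ∈ F, y ≠ x → w x ∉ y) ∧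
    Ew = w '' (↑F : Set (Set Ω))

/-- Condition (A). -/
def CondA (S : Set (Set Ω)) : Prop :=
  ∀ k : ℕ, ∀ p ∈ insert (∅ : Set Ω) S, InfiniteBreadth (proj S pᶜ) →
    ∃ F : Finset (Set Ω), ↑F ⊆ ominus S p ∧ F.card = k ∧ Incompressible F ∧
      InfiniteBreadth (proj (ominus S p) (⋃₀ (↑F : Set (Set Ω)))ᶜ)

/-- Condition (B). -/
def CondB (S : Set (Set Ω)) : Prop :=
  ∀ k : ℕ, ∀ c Γ : Set Ω, InfiniteBreadth (proj (avoid S Γ) c) →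
    ∃ F : Finset (Set Ω), ↑F ⊆ proj (avoid S Γ) c ∧ F.card = k ∧ Incompressible F ∧
      ∃ Ew : Set Ω, IsWitness F Ew ∧ InfiniteBreadth (proj (avoid S (Γ ∪ Ew)) c)

/-- Incompressibility in an abstract (sup-)semilattice: the product (sup) over any proper
nonempty subset differs from the product over the whole set. -/
def AIncomp {S : Type*} [SemilatticeSup S] (E : Finset S) : Prop :=
  ∀ E' ⊂ E, ∀ (h' : E'.Nonempty) (h : E.Nonempty), E'.sup' h' id ≠ E.sup' h id

/-- Incompressibility in an abstract meet-semilattice. -/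
def AIncompInf {S : Type*} [SemilatticeInf S] (E : Finset S) : Prop :=
  ∀ E' ⊂ E, ∀ (h' : E'.Nonempty) (h : E.Nonempty), E'.inf' h' id ≠ E.inf' h id

/-- The standard spread on ℕ × ℕ: `E0 n = {(n,k) : k ≤ n}` (0-based, |E0 n| = n+1). -/
def E0 : ℕ → Set (ℕ × ℕ) := fun n => {p | p.1 = n ∧ p.2 ≤ n}

universe u



/-- `R p q`: the first coordinate of `p` contains the point given by the second one of `q`. -/
def RelR {S : Type*} [SemilatticeSup S] (p q : S × S) : Prop := ¬ p.1 ≤ q.2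

def GoodF {S : Type*} [SemilatticeSup S] (t : Finset (S × S)) : Prop :=
  ∀ p ∈ t, ∀ q ∈ t, (RelR p q ↔ p = q)

def BddA {S : Type*} [SemilatticeSup S] (A : Set (S × S)) : Prop :=
  ∃ B : ℕ, ∀ t : Finset (S × S), GoodF t → (↑t : Set (S × S)) ⊆ A → t.card ≤ B

theorem exists_good {S : Type*} [SemilatticeSup S]
    (hS : ∀ n : ℕ, ∃ E : Finset S, E.card = n ∧ AIncomp E) (n : ℕ) :
    ∃ t : Finset (S × S), GoodF t ∧ n < t.card := by
  obtain ⟨E, hc, hE⟩ := hS (n + 2)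
  have hne : ∀ e ∈ E, (E.erase e).Nonempty := by
    intro e he
    rw [← Finset.card_pos, Finset.card_erase_of_mem he]; omega
  let w : S → S := fun e => if h : (E.erase e).Nonempty then (E.erase e).sup' h id else e
  have hw : ∀ e (he : e ∈ E), w e = (E.erase e).sup' (hne e he) id := by
    intro e he
    simp [w, hne e he]
  have h1 : ∀ e ∈ E, ¬ e ≤ w e := by
    intro e he hle
    rw [hw e he] at hle
    refine hE (E.erase e) (Finset.erase_ssubset he) (hne e he) ⟨e, he⟩ ?_
    apply le_antisymm
    · exact Finset.sup'_mono _ (Finset.erase_subset _ _) _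
    · apply Finset.sup'_le
      intro b hb
      by_cases hbe : b = e
      · subst hbe; exact hle
      · exact Finset.le_sup' id (Finset.mem_erase.2 ⟨hbe, hb⟩)
  have h2 : ∀ e ∈ E, ∀ b ∈ E, b ≠ e → b ≤ w e := by
    intro e he b hb hbe
    rw [hw e he]
    exact Finset.le_sup' id (Finset.mem_erase.2 ⟨hbe, hb⟩)
  refine ⟨E.image (fun e => (e, w e)), ?_, ?_⟩
  · intro p hp q hq
    obtain ⟨a, ha, rfl⟩ := Finset.mem_image.1 hp
    obtain ⟨b, hb, rfl⟩ := Finset.mem_image.1 hq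
    constructor
    · intro h
      by_contra hne'
      exact h (h2 b hb a ha (fun hab => hne' (by rw [hab])))
    · intro h
      have hab : a = b := congrArg Prod.fst h
      subst hab
      exact h1 a ha
  · rw [Finset.card_image_of_injective _ (fun a b h => congrArg Prod.fst h), hc]
    omega

theorem exists_ultra {S : Type*} [SemilatticeSup S]
    (hS : ∀ n : ℕ, ∃ E : Finset S, E.card = n ∧ AIncomp E) :
    ∃ U : Ultrafilter (S × S), ∀ A ∈ U, ¬ BddA A := by
  let F : Filter (S × S) := Filter.comk BddA
    ⟨0, fun t _ ht => by
      have : t = ∅ := by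
        rw [← Finset.coe_eq_empty]; exact Set.subset_empty_iff.1 ht
      simp [this]⟩
    (fun A ⟨B, hB⟩ A' hA => ⟨B, fun t ht hs => hB t ht (hs.trans hA)⟩)
    (fun A ⟨B, hB⟩ A' ⟨B', hB'⟩ => ⟨B + B', fun t ht hs => by
      have e1 := hB (t.filter (· ∈ A))
        (fun p hp q hq => ht p (Finset.mem_filter.1 hp).1 q (Finset.mem_filter.1 hq).1)
        (fun p hp => (Finset.mem_filter.1 hp).2)
      have e2 := hB' (t.filter (· ∉ A))
        (fun p hp q hq => ht p (Finset.mem_filter.1 hp).1 q (Finset.mem_filter.1 hq).1)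
        (fun p hp => (hs (Finset.mem_filter.1 hp).1).resolve_left (Finset.mem_filter.1 hp).2)
      have e3 := Finset.card_filter_add_card_filter_not (s := t) (· ∈ A)
      omega⟩)
  have hF : F.NeBot := by
    rw [Filter.neBot_iff]
    intro hbot
    have : (∅ : Set (S × S)) ∈ F := by rw [hbot]; trivial
    have h' : BddA ((∅ : Set (S × S))ᶜ) := this
    rw [Set.compl_empty] at h'
    obtain ⟨B, hB⟩ := h'
    obtain ⟨t, ht, hlt⟩ := exists_good hS B
    exact absurd (hB t ht (Set.subset_univ _)) (by omega)
  refine ⟨Ultrafilter.of F, fun A hA hb => ?_⟩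
  have : Aᶜ ∈ F := by
    change BddA (Aᶜᶜ)
    rw [compl_compl]; exact hb
  exact (Ultrafilter.compl_mem_iff_notMem.1 (Ultrafilter.of_le F this)) hA

theorem exists_grid {S : Type*} [SemilatticeSup S]
    (hS : ∀ n : ℕ, ∃ E : Finset S, E.card = n ∧ AIncomp E) :
    ∃ (ε δ : Prop) (e : ℕ → ℕ → S × S),
      (∀ n m k l, k ≤ n → l ≤ m → n < m → (RelR (e n k) (e m l) ↔ ε)) ∧
      (∀ n m k l, k ≤ n → l ≤ m → n < m → (RelR (e m l) (e n k) ↔ δ)) ∧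
      (∀ n k l, k ≤ n → l ≤ n → (RelR (e n k) (e n l) ↔ k = l)) := by
  obtain ⟨U, hU⟩ := exists_ultra hS
  have key : ∀ R : S × S → S × S → Prop, ∃ ε : Prop, ∀ᶠ p in U, ∀ᶠ q in U, (R p q ↔ ε) := by
    intro R
    refine ⟨∀ᶠ p in U, ∀ᶠ q in U, R p q, ?_⟩
    by_cases h : ∀ᶠ p in U, ∀ᶠ q in U, R p q
    · simpa [h] using h
    · simp only [h, iff_false]
      have h' := Ultrafilter.eventually_not.2 h
      exact h'.mono fun p hp => Ultrafilter.eventually_not.2 hp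
  obtain ⟨ε, hε⟩ := key RelR
  obtain ⟨δ, hδ⟩ := key (fun p q => RelR q p)
  let G : Set (S × S) := {p | (∀ᶠ q in U, (RelR p q ↔ ε)) ∧ (∀ᶠ q in U, (RelR q p ↔ δ))}
  have hG : ∀ᶠ p in U, p ∈ G := hε.and hδ
  obtain ⟨f, hf, hr⟩ := exists_seq_of_forall_finset_exists
    (α := Finset (S × S))
    (fun t => GoodF t ∧ (↑t : Set (S × S)) ⊆ G ∧ 0 < t.card)
    (fun t t' => t.card < t'.card ∧
      ∀ p ∈ t, ∀ q ∈ t', (RelR p q ↔ ε) ∧ (RelR q p ↔ δ)) (by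
    intro s hs
    let Q : Finset (S × S) := s.biUnion id
    have hQ : ∀ᶠ q in U, q ∈ G ∧ ∀ p ∈ Q, (RelR p q ↔ ε) ∧ (RelR q p ↔ δ) := by
      refine hG.and ?_
      rw [Filter.eventually_all_finset]
      intro p hp
      obtain ⟨t, ht, hpt⟩ := Finset.mem_biUnion.1 hp
      have := (hs t ht).2.1 hpt
      exact this.1.and this.2
    have hnb := hU _ hQ
    unfold BddA at hnb
    push Not at hnb
    obtain ⟨t, ht, hsub, hcard⟩ := hnb (s.sup Finset.card)
    refine ⟨t, ⟨ht, fun q hq => (hsub hq).1, by omega⟩, fun x hx => ⟨?_, ?_⟩⟩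
    · exact lt_of_le_of_lt (Finset.le_sup (f := Finset.card) hx) hcard
    · intro p hp q hq
      exact (hsub hq).2 p (Finset.mem_biUnion.2 ⟨x, hx, hp⟩))
  have hcard : ∀ n, n < (f n).card := by
    intro n
    induction n with
    | zero => exact (hf 0).2.2
    | succ n ih => have := (hr n (n+1) (Nat.lt_succ_self n)).1; omega
  have hemb : ∀ n, ∃ g : ℕ → S × S, (∀ k ≤ n, g k ∈ f n) ∧
      ∀ k ≤ n, ∀ l ≤ n, g k = g l → k = l := by
    intro n
    have hp : 0 < (f n).card := (hf n).2.2
    refine ⟨fun k => if h : k < (f n).card then ((f n).equivFin.symm ⟨k, h⟩).1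
      else ((f n).equivFin.symm ⟨0, hp⟩).1, ?_, ?_⟩
    · intro k hk
      have : k < (f n).card := lt_of_le_of_lt hk (hcard n)
      simp [this]
    · intro k hk l hl h
      have h1 : k < (f n).card := lt_of_le_of_lt hk (hcard n)
      have h2 : l < (f n).card := lt_of_le_of_lt hl (hcard n)
      simp only [h1, h2, dif_pos] at h
      have := (f n).equivFin.symm.injective (Subtype.ext h)
      simpa using this
  choose e he hinj using hemb
  refine ⟨ε, δ, e, ?_, ?_, ?_⟩
  · intro n m k l hk hl hnm
    exact ((hr n m hnm).2 _ (he n k hk) _ (he m l hl)).1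
  · intro n m k l hk hl hnm
    exact ((hr n m hnm).2 _ (he n k hk) _ (he m l hl)).2
  · intro n k l hk hl
    rw [(hf n).1 _ (he n k hk) _ (he n l hl)]
    exact ⟨hinj n k hk l hl, fun h => by rw [h]⟩

/-- The representation map. -/
def phiR {S : Type*} [SemilatticeSup S] (e : ℕ → ℕ → S × S) (s : S) : Set (ℕ × ℕ) :=
  {p | p.2 ≤ p.1 ∧ ¬ s ≤ (e p.1 p.2).2}

theorem phiR_sup {S : Type*} [SemilatticeSup S] (e : ℕ → ℕ → S × S) (s t : S) :
    phiR e (s ⊔ t) = phiR e s ∪ phiR e t := by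
  ext p
  simp only [phiR, Set.mem_ofPred_eq, Set.mem_union, sup_le_iff]
  tauto

theorem phiR_range {S : Type*} [SemilatticeSup S] (e : ℕ → ℕ → S × S)
    {A : Set (ℕ × ℕ)} (hA : A.Finite) (hne : A.Nonempty) :
    ∃ s, phiR e s = {q | q.2 ≤ q.1 ∧ ∃ p ∈ A, RelR (e p.1 p.2) (e q.1 q.2)} := by
  have hne' : hA.toFinset.Nonempty := by simpa using hne
  refine ⟨hA.toFinset.sup' hne' (fun p => (e p.1 p.2).1), ?_⟩
  ext q
  simp [phiR, RelR]

theorem E0_finite (n : ℕ) : (E0 n).Finite :=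
  ((Set.finite_Iic n).prod (Set.finite_Iic n)).subset (by
    rintro ⟨a, b⟩ ⟨h1, h2⟩
    simp only at h1 h2
    exact ⟨by simp [h1], by simpa using h2⟩)

theorem mem_lowE (n m l : ℕ) : (m, l) ∈ (⋃ k < n, E0 k) ↔ m < n ∧ l ≤ m := by
  simp [E0]

theorem mem_highE (n m l : ℕ) : (m, l) ∈ (⋃ k > n, E0 k) ↔ n < m ∧ l ≤ m := by
  simp [E0]

theorem finish_thm {S : Type u} [SemilatticeSup S] [Nonempty S] (e : ℕ → ℕ → S × S) :
    ∃ (T : Type u) (_ : SemilatticeSup T) (f : S → T),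
      Function.Surjective f ∧ (∀ x y : S, f (x ⊔ y) = f x ⊔ f y) ∧
      ∃ g : Set (ℕ × ℕ) → T, ∀ K : Set (Set (ℕ × ℕ)), K ⊆ Set.range (phiR e) →
        Set.InjOn g K ∧ ∀ x ∈ K, ∀ y ∈ K, g (x ∪ y) = g x ⊔ g y := by
  have hcl : ∀ ⦃x y : Set (ℕ × ℕ)⦄, x ∈ Set.range (phiR e) → y ∈ Set.range (phiR e) →
      x ⊔ y ∈ Set.range (phiR e) := by
    rintro _ _ ⟨s, rfl⟩ ⟨t, rfl⟩
    exact ⟨s ⊔ t, phiR_sup e s t⟩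
  letI : SemilatticeSup {x // x ∈ Set.range (phiR e)} := Subtype.semilatticeSup hcl
  have s0 : S := Classical.arbitrary S
  refine ⟨ULift.{u} {x // x ∈ Set.range (phiR e)}, inferInstance,
    fun s => ⟨⟨phiR e s, s, rfl⟩⟩, ?_, ?_,
    fun x => if h : x ∈ Set.range (phiR e) then ⟨⟨x, h⟩⟩ else ⟨⟨phiR e s0, s0, rfl⟩⟩, ?_⟩
  · rintro ⟨⟨_, s, rfl⟩⟩
    exact ⟨s, rfl⟩
  · intro x y
    apply ULift.ext
    apply Subtype.ext
    exact phiR_sup e x y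
  · intro K hK
    constructor
    · intro x hx y hy hxy
      simp only [dif_pos (hK hx), dif_pos (hK hy)] at hxy
      exact congrArg (fun z => z.down.1) hxy
    · intro x hx y hy
      have h3 : x ∪ y ∈ Set.range (phiR e) := hcl (hK hx) (hK hy)
      simp only [dif_pos (hK hx), dif_pos (hK hy), dif_pos h3]
      rfl

/-- Theorem (Subquotient theorem, abstract version): a semilattice of infinite breadth
has a homomorphic image containing a copy of `T_max`, `T_min` or `T_ort`. -/
theorem stmt0 {S : Type u} [SemilatticeSup S]
    (hS : ∀ n : ℕ, ∃ E : Finset S, E.card = n ∧ AIncomp E) :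
    ∃ (T : Type u) (_ : SemilatticeSup T) (f : S → T),
      Function.Surjective f ∧ (∀ x y : S, f (x ⊔ y) = f x ⊔ f y) ∧
      ∃ g : Set (ℕ × ℕ) → T,
        ((Set.InjOn g (Tmax E0) ∧
            ∀ x ∈ Tmax E0, ∀ y ∈ Tmax E0, g (x ∪ y) = g x ⊔ g y) ∨
         (Set.InjOn g (Tmin E0) ∧
            ∀ x ∈ Tmin E0, ∀ y ∈ Tmin E0, g (x ∪ y) = g x ⊔ g y) ∨
         (Set.InjOn g (Tort E0) ∧
            ∀ x ∈ Tort E0, ∀ y ∈ Tort E0, g (x ∪ y) = g x ⊔ g y)) := by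
  have : Nonempty S := by
    obtain ⟨E, hE, -⟩ := hS 1
    obtain ⟨a, -⟩ := Finset.card_pos.1 (by omega : 0 < E.card)
    exact ⟨a⟩
  obtain ⟨ε, δ, e, h1, h2, h3⟩ := exists_grid hS
  obtain ⟨T, i, f, hf, hf', g, hg⟩ := finish_thm e
  refine ⟨T, i, f, hf, hf', g, ?_⟩
  have hlev : ∀ n (a : Set (ℕ × ℕ)), a ⊆ E0 n → a.Nonempty →
      ∃ s, phiR e s = {q | q.2 ≤ q.1 ∧ (q.1 < n ∧ δ ∨ q ∈ a ∨ n < q.1 ∧ ε)} := by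
    intro n a ha hne
    obtain ⟨s, hs⟩ := phiR_range e ((E0_finite n).subset ha) hne
    refine ⟨s, ?_⟩
    rw [hs]
    ext ⟨m, l⟩
    simp only [Set.mem_ofPred_eq]
    refine and_congr_right fun hl => ?_
    have hrel : ∀ p ∈ a, (RelR (e p.1 p.2) (e m l) ↔
        (m < n ∧ δ ∨ (m, l) = p ∨ n < m ∧ ε)) := by
      rintro ⟨n', k⟩ hp
      obtain ⟨hp1, hp2⟩ := ha hp
      simp only at hp1 hp2
      subst hp1
      rcases lt_trichotomy m n' with h | h | h
      · have := h2 m n' l k hl hp2 h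
        simp [this, h, h.ne, h.not_gt]
      · subst h
        have := h3 m k l hp2 hl
        simp [this, eq_comm]
      · have := h1 n' m k l hp2 hl h
        simp [this, h, h.ne', h.not_gt]
    constructor
    · rintro ⟨p, hp, hR⟩
      rcases (hrel p hp).1 hR with h | h | h
      · exact Or.inl h
      · exact Or.inr (Or.inl (h ▸ hp))
      · exact Or.inr (Or.inr h)
    · obtain ⟨p, hp⟩ := hne
      rintro (h | h | h)
      · exact ⟨p, hp, (hrel p hp).2 (Or.inl h)⟩
      · exact ⟨_, h, (hrel _ h).2 (Or.inr (Or.inl rfl))⟩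
      · exact ⟨p, hp, (hrel p hp).2 (Or.inr (Or.inr h))⟩
  have ha2 : ∀ n (a : Set (ℕ × ℕ)), a ⊆ E0 n → ∀ m l, (m, l) ∈ a → m = n ∧ l ≤ n :=
    fun n a ha m l h => ha h
  by_cases hε : ε
  · by_cases hδ : δ
    · right; right
      apply hg
      rintro x ⟨n, a, ha, hne, rfl⟩
      obtain ⟨s, hs⟩ := hlev n a ha hne
      refine ⟨s, hs.trans ?_⟩
      ext ⟨m, l⟩
      have := ha2 n a ha m l
      simp only [hε, hδ, Set.mem_ofPred_eq, Set.mem_union, mem_lowE, mem_highE]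
      clear * - this
      grind
    · right; left
      apply hg
      rintro x ⟨n, a, ha, hne, rfl⟩
      obtain ⟨s, hs⟩ := hlev n a ha hne
      refine ⟨s, hs.trans ?_⟩
      ext ⟨m, l⟩
      have := ha2 n a ha m l
      simp only [hε, hδ, Set.mem_ofPred_eq, Set.mem_union, mem_lowE, mem_highE]
      clear * - this
      grind
  · left
    apply hg
    rintro x ⟨n, a, ha, hne, rfl⟩
    by_cases hδ : δ
    · obtain ⟨s, hs⟩ := hlev n a ha hne
      refine ⟨s, hs.trans ?_⟩
      ext ⟨m, l⟩
      have := ha2 n a ha m l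
      simp only [hε, hδ, Set.mem_ofPred_eq, Set.mem_union, mem_lowE, mem_highE]
      clear * - this
      grind
    · have hfin : ((⋃ k < n, E0 k) ∪ a).Finite :=
        ((Set.finite_Iio n).biUnion (fun k _ => E0_finite k)).union ((E0_finite n).subset ha)
      obtain ⟨s, hs⟩ := phiR_range e hfin (hne.mono Set.subset_union_right)
      refine ⟨s, hs.trans ?_⟩
      have hle : ∀ p ∈ (⋃ k < n, E0 k) ∪ a, p.2 ≤ p.1 := by
        rintro ⟨m, l⟩ hp
        have := ha2 n a ha m l
        simp only [Set.mem_union, mem_lowE] at hp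
        clear * - this hp
        clear * - this hp
        grind
      ext ⟨m, l⟩
      simp only [Set.mem_ofPred_eq]
      constructor
      · rintro ⟨hl, ⟨n', k⟩, hp, hR⟩
        have hk := hle _ hp
        simp only at hk hR
        rcases lt_trichotomy m n' with h | h | h
        · exact absurd ((h2 m n' l k hl hk h).1 hR) hδ
        · subst h
          have := (h3 m k l hk hl).1 hR
          exact this ▸ hp
        · exact absurd ((h1 n' m k l hk hl h).1 hR) hε
      · intro hp
        have hl := hle _ hp
        exact ⟨hl, _, hp, (h3 m l l hl hl).2 rfl⟩
end

section
/- Let S be a union-closed set system on a set Ω and let ℰ be a spread in Ω. Then at least one of the following holds: (D1) there exist a spread G refining ℰ and a sequence (a_i)_{i≥1} of members of S which shatters G; or (D2) there exist a spread F refining ℰ and a finite partition 𝒞 of Ω which colours F and is S-decisive for F. -/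
open Set Filter
open scoped Classical

variable {Ω : Type*}

theorem aux_extract (E : ℕ → Set Ω) (P : ℕ → ℕ → Prop) (hP : ∀ k, ∃ n, P k n)
    (hm : ∀ k l n, k ≤ l → P l n → P k n) (hc : ∀ k n, P k n → k ≤ (E n).ncard) :
    ∃ φ : ℕ → ℕ, StrictMono φ ∧ ∀ k, P k (φ k) := by
  apply Filter.extraction_forall_of_frequently
  intro k
  rw [Filter.frequently_atTop]
  intro N
  obtain ⟨n, hn⟩ := hP (k + ∑ i ∈ Finset.range N, (E i).ncard + 1)
  refine ⟨n, ?_, hm _ _ _ (by omega) hn⟩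
  by_contra h
  have h1 := hc _ _ hn
  have h2 : (E n).ncard ≤ ∑ i ∈ Finset.range N, (E i).ncard :=
    Finset.single_le_sum (f := fun i => (E i).ncard) (fun _ _ => Nat.zero_le _)
      (Finset.mem_range.2 (by omega))
  omega

theorem aux_refines (E : ℕ → Set Ω) (hE : IsSpread E) (φ : ℕ → ℕ) (hφ : StrictMono φ) :
    Refines (fun n => E (φ n)) E := by
  obtain ⟨h1, h2, h3, h4⟩ := hE
  refine ⟨⟨fun n => h1 _, fun n => h2 _, fun m n h => h3 _ _ (hφ.injective.ne h),
    h4.comp hφ.tendsto_atTop⟩, φ, hφ.injective, fun j => subset_rfl⟩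

theorem aux_mono (E : ℕ → Set Ω) (hE : IsSpread E) {a b : Set Ω} {n B : ℕ} (h : a ⊆ b)
    (hB : B ≤ (a ∩ E n).ncard) : B ≤ (b ∩ E n).ncard :=
  hB.trans (Set.ncard_le_ncard (Set.inter_subset_inter_left _ h)
    ((hE.1 n).subset Set.inter_subset_right))

theorem aux_A (S : Set (Set Ω)) (E : ℕ → Set Ω) (hE : IsSpread E)
    (hD : ¬ ∃ F : ℕ → Set Ω, Refines F E ∧
        ∃ C : Finset (Set Ω), IsPartitionC C ∧ Colours C F ∧ Decisive S C F)
    (C D : Finset (Set Ω)) (hCD : C ⊆ D) (hC : IsPartitionC C) (c₀ : Set Ω) (hc₀ : c₀ ∈ C)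
    (hQ : ∀ B, ∃ n, ∀ d ∈ D, B ≤ (d ∩ E n).ncard) :
    ∃ x ∈ S, ∀ B, ∃ n, B ≤ (x ∩ c₀ ∩ E n).ncard ∧
      (∀ c ∈ C, B ≤ (xᶜ ∩ c ∩ E n).ncard) ∧ ∀ d ∈ D, B ≤ (d ∩ E n).ncard := by
  obtain ⟨φ, hφ, hφP⟩ := aux_extract E (fun B n => ∀ d ∈ D, B ≤ (d ∩ E n).ncard) hQ
    (fun k l n hkl h d hd => hkl.trans (h d hd))
    (fun k n h => (h c₀ (hCD hc₀)).trans (Set.ncard_le_ncard Set.inter_subset_right (hE.1 n)))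
  have hcol : Colours C (fun n => E (φ n)) := fun c hc =>
    tendsto_atTop_mono (fun n => hφP n c (hCD hc)) tendsto_id
  have hdec : ¬ Decisive S C (fun n => E (φ n)) := fun h =>
    hD ⟨_, aux_refines E hE φ hφ, C, hC, hcol, h⟩
  unfold Decisive at hdec
  push Not at hdec
  obtain ⟨x, hx, h⟩ := hdec c₀ hc₀
  refine ⟨x, hx, fun B => ?_⟩
  obtain ⟨n, hn1, hn2⟩ := h (B + ∑ i ∈ Finset.range B, (E (φ i)).ncard)
  have hnB : B ≤ n := by
    by_contra hlt
    have h2 : (E (φ n)).ncard ≤ ∑ i ∈ Finset.range B, (E (φ i)).ncard :=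
      Finset.single_le_sum (f := fun i => (E (φ i)).ncard) (fun _ _ => Nat.zero_le _)
        (Finset.mem_range.2 (by omega))
    have h3 : (x ∩ c₀ ∩ E (φ n)).ncard ≤ (E (φ n)).ncard :=
      Set.ncard_le_ncard Set.inter_subset_right (hE.1 _)
    omega
  exact ⟨φ n, by omega, fun c hc => by have := hn2 c hc; omega,
    fun d hd => hnB.trans (hφP n d hd)⟩

theorem aux_B (S : Set (Set Ω)) (hS : UnionClosed S) (E : ℕ → Set Ω) (hE : IsSpread E)
    (hD : ¬ ∃ F : ℕ → Set Ω, Refines F E ∧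
        ∃ C : Finset (Set Ω), IsPartitionC C ∧ Colours C F ∧ Decisive S C F)
    (C : Finset (Set Ω)) (hC : IsPartitionC C)
    (hQ : ∀ B, ∃ n, ∀ d ∈ C, B ≤ (d ∩ E n).ncard)
    (T : Finset (Set Ω)) (hT : T.Nonempty) (hTC : T ⊆ C) :
    ∃ x ∈ S, ∀ B, ∃ n, (∀ c ∈ T, B ≤ (x ∩ c ∩ E n).ncard) ∧
      (∀ c ∈ C, B ≤ (xᶜ ∩ c ∩ E n).ncard) := by
  induction hT using Finset.Nonempty.cons_induction with
  | singleton c =>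
    obtain ⟨x, hx, h⟩ := aux_A S E hE hD C C subset_rfl hC c (hTC (by simp)) hQ
    refine ⟨x, hx, fun B => ?_⟩
    obtain ⟨n, h1, h2, -⟩ := h B
    exact ⟨n, by simpa using h1, h2⟩
  | cons c₀ T hc hT ih =>
    obtain ⟨x, hx, h⟩ := ih (fun t ht => hTC (by simp [ht]))
    have hc₀ : c₀ ∈ C := hTC (by simp)
    have hp : IsPartitionC (insert x (C.image (fun c => xᶜ ∩ c))) := by
      refine ⟨?_, ?_⟩
      · intro a ha b hb hab
        simp only [Finset.mem_insert, Finset.mem_image] at ha hb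
        rcases ha with rfl | ⟨c, hc, rfl⟩ <;> rcases hb with rfl | ⟨d, hd, rfl⟩
        · exact absurd rfl hab
        · exact Set.disjoint_left.2 fun z hz hz' => hz'.1 hz
        · exact Set.disjoint_left.2 fun z hz hz' => hz.1 hz'
        · have hcd : c ≠ d := fun e => hab (by rw [e])
          exact (hC.1 c hc d hd hcd).mono Set.inter_subset_right Set.inter_subset_right
      · rw [Set.eq_univ_iff_forall]
        intro z
        by_cases hz : z ∈ x
        · exact ⟨x, by simp, hz⟩
        · obtain ⟨c, hc, hzc⟩ : z ∈ ⋃₀ (↑C : Set (Set Ω)) := by rw [hC.2]; trivial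
          exact ⟨xᶜ ∩ c, Finset.mem_coe.2
            (Finset.mem_insert_of_mem (Finset.mem_image_of_mem _ hc)), hz, hzc⟩
    have hq : ∀ B, ∃ n, ∀ d ∈ insert x (C.image (fun c => xᶜ ∩ c)) ∪ T.image (fun c => x ∩ c),
        B ≤ (d ∩ E n).ncard := by
      intro B
      obtain ⟨n, h1, h2⟩ := h B
      refine ⟨n, fun d hd => ?_⟩
      simp only [Finset.mem_union, Finset.mem_insert, Finset.mem_image] at hd
      rcases hd with (rfl | ⟨c, hc, rfl⟩) | ⟨c, hc, rfl⟩
      · obtain ⟨t, ht⟩ := hT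
        exact aux_mono E hE Set.inter_subset_left (h1 t ht)
      · exact h2 c hc
      · exact h1 c hc
    obtain ⟨y, hy, hh⟩ := aux_A S E hE hD (insert x (C.image (fun c => xᶜ ∩ c)))
      (insert x (C.image (fun c => xᶜ ∩ c)) ∪ T.image (fun c => x ∩ c))
      Finset.subset_union_left hp (xᶜ ∩ c₀)
      (Finset.mem_insert_of_mem (Finset.mem_image_of_mem _ hc₀)) hq
    · refine ⟨x ∪ y, hS x hx y hy, fun B => ?_⟩
      obtain ⟨n, h1, h2, h3⟩ := hh B
      refine ⟨n, fun c hcT => ?_, fun c hcC => ?_⟩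
      · rcases Finset.mem_cons.1 hcT with rfl | hcT
        · exact aux_mono E hE (fun z hz => ⟨Or.inr hz.1, hz.2.2⟩) h1
        · refine aux_mono E hE (fun z hz => ⟨Or.inl hz.1, hz.2⟩) (h3 (x ∩ c) ?_)
          exact Finset.mem_union_right _ (Finset.mem_image_of_mem _ hcT)
      · refine aux_mono E hE (fun z hz => ⟨?_, hz.2.2⟩) (h2 (xᶜ ∩ c)
          (Finset.mem_insert_of_mem (Finset.mem_image_of_mem _ hcC)))
        rintro (h | h)
        · exact hz.2.1 h
        · exact hz.1 h

noncomputable def auxNext (C : Finset (Set Ω)) (x : Set Ω) : Finset (Set Ω) :=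
  C.image (fun c => x ∩ c) ∪ C.image (fun c => xᶜ ∩ c)

theorem aux_step (S : Set (Set Ω)) (hS : UnionClosed S) (E : ℕ → Set Ω) (hE : IsSpread E)
    (hD : ¬ ∃ F : ℕ → Set Ω, Refines F E ∧
        ∃ C : Finset (Set Ω), IsPartitionC C ∧ Colours C F ∧ Decisive S C F)
    (C : Finset (Set Ω)) (hC : IsPartitionC C)
    (hQ : ∀ B, ∃ n, ∀ d ∈ C, B ≤ (d ∩ E n).ncard) :
    ∃ x ∈ S, IsPartitionC (auxNext C x) ∧
      ∀ B, ∃ n, ∀ d ∈ auxNext C x, B ≤ (d ∩ E n).ncard := by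
  have hne : C.Nonempty := by
    obtain ⟨z, -⟩ := hE.2.1 0
    obtain ⟨c, hc, -⟩ : z ∈ ⋃₀ (↑C : Set (Set Ω)) := by rw [hC.2]; trivial
    exact ⟨c, hc⟩
  obtain ⟨x, hx, h⟩ := aux_B S hS E hE hD C hC hQ C hne subset_rfl
  refine ⟨x, hx, ⟨?_, ?_⟩, fun B => ?_⟩
  · intro a ha b hb hab
    simp only [auxNext, Finset.mem_union, Finset.mem_image] at ha hb
    rcases ha with ⟨c, hc, rfl⟩ | ⟨c, hc, rfl⟩ <;> rcases hb with ⟨d, hd, rfl⟩ | ⟨d, hd, rfl⟩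
    · have hcd : c ≠ d := fun e => hab (by rw [e])
      exact (hC.1 c hc d hd hcd).mono Set.inter_subset_right Set.inter_subset_right
    · exact Set.disjoint_left.2 fun z hz hz' => hz'.1 hz.1
    · exact Set.disjoint_left.2 fun z hz hz' => hz.1 hz'.1
    · have hcd : c ≠ d := fun e => hab (by rw [e])
      exact (hC.1 c hc d hd hcd).mono Set.inter_subset_right Set.inter_subset_right
  · rw [Set.eq_univ_iff_forall]
    intro z
    obtain ⟨c, hc, hzc⟩ : z ∈ ⋃₀ (↑C : Set (Set Ω)) := by rw [hC.2]; trivial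
    by_cases hz : z ∈ x
    · exact ⟨x ∩ c, Finset.mem_coe.2
        (Finset.mem_union_left _ (Finset.mem_image_of_mem _ hc)), hz, hzc⟩
    · exact ⟨xᶜ ∩ c, Finset.mem_coe.2
        (Finset.mem_union_right _ (Finset.mem_image_of_mem _ hc)), hz, hzc⟩
  · obtain ⟨n, h1, h2⟩ := h B
    refine ⟨n, fun d hd => ?_⟩
    simp only [auxNext, Finset.mem_union, Finset.mem_image] at hd
    rcases hd with ⟨c, hc, rfl⟩ | ⟨c, hc, rfl⟩
    · exact h1 c hc
    · exact h2 c hc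

/-- Theorem (Controlled or fragmented). -/
theorem stmt9 {Ω : Type*} (S : Set (Set Ω)) (hS : UnionClosed S)
    (E : ℕ → Set Ω) (hE : IsSpread E) :
    (∃ G : ℕ → Set Ω, Refines G E ∧
        ∃ a : ℕ → Set Ω, (∀ i, a i ∈ S) ∧ Shatters a G) ∨
    (∃ F : ℕ → Set Ω, Refines F E ∧
        ∃ C : Finset (Set Ω), IsPartitionC C ∧ Colours C F ∧ Decisive S C F) := by
  by_cases hD : ∃ F : ℕ → Set Ω, Refines F E ∧
        ∃ C : Finset (Set Ω), IsPartitionC C ∧ Colours C F ∧ Decisive S C F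
  · exact Or.inr hD
  refine Or.inl ?_
  let P := {C : Finset (Set Ω) // IsPartitionC C ∧ ∀ B, ∃ n, ∀ d ∈ C, B ≤ (d ∩ E n).ncard}
  have hstep : ∀ C : P, ∃ x ∈ S, IsPartitionC (auxNext C.1 x) ∧
      ∀ B, ∃ n, ∀ d ∈ auxNext C.1 x, B ≤ (d ∩ E n).ncard := fun C =>
    aux_step S hS E hE hD C.1 C.2.1 C.2.2
  choose f hfS hf using hstep
  let C0 : P := ⟨{univ}, ⟨by simp, by simp⟩, fun B => by
    obtain ⟨n, hn⟩ := (hE.2.2.2.eventually (eventually_ge_atTop B)).exists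
    exact ⟨n, by simpa using hn⟩⟩
  let c : ℕ → P := fun n => Nat.rec C0 (fun _ C => ⟨auxNext C.1 (f C), hf C⟩) n
  have hcs : ∀ k, (c (k + 1)).1 = auxNext (c k).1 (f (c k)) := fun k => rfl
  let a : ℕ → Set Ω := fun k => f (c k)
  have hatom : ∀ (m : ℕ) (y : ℕ → Set Ω), (∀ j < m, y j = a j ∨ y j = (a j)ᶜ) →
      (⋂ j < m, y j) ∈ (c m).1 := by
    intro m y
    induction m with
    | zero => intro _; simp [c, C0]
    | succ m ih =>
      intro hy
      have h1 := ih fun j hj => hy j (by omega)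
      have h2 : (⋂ j < m + 1, y j) = y m ∩ ⋂ j < m, y j := by
        ext z
        simp only [Set.mem_iInter, Set.mem_inter_iff]
        refine ⟨fun h => ⟨h m (by omega), fun j hj => h j (by omega)⟩, fun h j hj => ?_⟩
        rcases Nat.lt_succ_iff_lt_or_eq.1 hj with h' | rfl
        · exact h.2 j h'
        · exact h.1
      rw [h2, hcs, auxNext]
      rcases hy m (by omega) with e | e <;> rw [e]
      · exact Finset.mem_union_left _ (Finset.mem_image_of_mem (fun c => _ ∩ c) h1)
      · exact Finset.mem_union_right _ (Finset.mem_image_of_mem (fun c => _ ∩ c) h1)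
  have hbig : ∀ k, ∃ n, ∀ l ≤ k, ∀ y : ℕ → Set Ω, (∀ j < l, y j = a j ∨ y j = (a j)ᶜ) →
      k ≤ ((⋂ j < l, y j) ∩ E n).ncard := by
    intro k
    obtain ⟨n, hn⟩ := (c k).2.2 k
    refine ⟨n, fun l hl y hy => ?_⟩
    refine aux_mono E hE ?_ (hn _ (hatom k (fun j => if j < l then y j else a j) ?_))
    · intro z hz
      simp only [Set.mem_iInter] at hz ⊢
      intro j hj
      simpa [hj] using hz j (by omega)
    · intro j hj
      by_cases h : j < l
      · simpa [h] using hy j h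
      · simp [h]
  obtain ⟨φ, hφ, hφP⟩ := aux_extract E (fun k n => ∀ l ≤ k, ∀ y : ℕ → Set Ω,
      (∀ j < l, y j = a j ∨ y j = (a j)ᶜ) → k ≤ ((⋂ j < l, y j) ∩ E n).ncard) hbig
    (fun k l n hkl h i hi y hy => hkl.trans (h i (hi.trans hkl) y hy))
    (fun k n h => by simpa using h 0 (Nat.zero_le _) a (by simp))
  refine ⟨_, aux_refines E hE φ hφ, a, fun i => hfS _, fun m y hy => ?_⟩
  refine tendsto_atTop_mono' atTop ?_ tendsto_id
  filter_upwards [eventually_ge_atTop m] with n hn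
  rw [Set.inter_comm]
  exact hφP n m hn y hy
end

section
/- Let S be a union-closed set system with finite breadth on a set Ω, and let ℰ be a spread in Ω. Then there exist a spread F refining ℰ and a finite partition 𝒞 of Ω which colours F and is S-decisive for F. -/
open Set Filter
open scoped Classical

variable {Ω : Type*}

/-- The invariant of the induction: `T` is a family of members of `S` which are pairwise
disjoint on `F`, each of them, and the complement of their union, being large on `F`. -/
def StepInv (S : Set (Set Ω)) (F : ℕ → Set Ω) (T : Finset (Set Ω)) : Prop :=
  (↑T : Set (Set Ω)) ⊆ S ∧
  (∀ n, ∀ p ∈ F n, ∀ x ∈ T, ∀ y ∈ T, p ∈ x → p ∈ y → x = y) ∧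
  (∀ x ∈ T, Tendsto (fun n => (x ∩ F n).ncard) atTop atTop) ∧
  Tendsto (fun n => (F n \ ⋃₀ (↑T : Set (Set Ω))).ncard) atTop atTop

theorem tendsto_of_lt (f : ℕ → ℕ) (h : ∀ k, k < f k) : Tendsto f atTop atTop :=
  tendsto_atTop_mono (fun k => (h k).le) tendsto_id

theorem stepInv_incompressible {S : Set (Set Ω)} {F : ℕ → Set Ω} {T : Finset (Set Ω)}
    (h : StepInv S F T) : Incompressible T := by
  obtain ⟨_, h2, h3, _⟩ := h
  intro T' hT' heq
  obtain ⟨hsub, x, hxT, hxT'⟩ := Finset.ssubset_iff_exists_subset_erase.mp hT' |> fun ⟨x, hx, hs⟩ =>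
    (⟨hT'.subset, x, hx, fun h => Finset.notMem_erase x T (hs h)⟩ :
      T' ⊆ T ∧ ∃ x, x ∈ T ∧ x ∉ T')
  obtain ⟨n, hn⟩ := ((h3 x hxT).eventually_ge_atTop 1).exists
  obtain ⟨p, hpx, hpF⟩ := nonempty_of_ncard_ne_zero (s := x ∩ F n) (by omega)
  have hp : p ∈ ⋃₀ (↑T : Set (Set Ω)) := ⟨x, by simpa using hxT, hpx⟩
  rw [← heq] at hp
  obtain ⟨y, hy, hpy⟩ := hp
  have hy' : y ∈ T' := by simpa using hy
  have := h2 n p hpF x hxT y (hsub hy') hpx hpy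
  exact hxT' (this ▸ hy')

/-- The points which lie in `x` and in no other member of `T`. -/
def privPart (T : Finset (Set Ω)) (x : Set Ω) : Set Ω := {p | p ∈ x ∧ ∀ y ∈ T, p ∈ y → y = x}

/-- The remaining colour class. -/
def restPart (T : Finset (Set Ω)) : Set Ω := {p | ∀ x ∈ T, p ∉ privPart T x}

/-- The partition attached to `T`. -/
noncomputable def partOf (T : Finset (Set Ω)) : Finset (Set Ω) :=
  insert (restPart T) (T.image (privPart T))

theorem partOf_isPartition (T : Finset (Set Ω)) : IsPartitionC (partOf T) := by
  constructor
  · intro c hc d hd hcd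
    rw [Set.disjoint_left]
    intro p hpc hpd
    simp only [partOf, Finset.mem_insert, Finset.mem_image] at hc hd
    rcases hc with rfl | ⟨x, hx, rfl⟩
    · rcases hd with rfl | ⟨y, hy, rfl⟩
      · exact hcd rfl
      · exact hpc y hy hpd
    · rcases hd with rfl | ⟨y, hy, rfl⟩
      · exact hpd x hx hpc
      · have := hpd.2 x hx hpc.1
        exact hcd (by rw [this])
  · ext p
    simp only [mem_univ, iff_true]
    by_cases h : ∃ x ∈ T, p ∈ privPart T x
    · obtain ⟨x, hx, hp⟩ := h
      exact ⟨privPart T x, by simp only [partOf, Finset.mem_coe, Finset.mem_insert, Finset.mem_image]; exact Or.inr ⟨x, hx, rfl⟩, hp⟩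
    · push Not at h
      exact ⟨restPart T, by simp [partOf], h⟩

theorem priv_inter {S : Set (Set Ω)} {F : ℕ → Set Ω} {T : Finset (Set Ω)}
    (h : StepInv S F T) {x : Set Ω} (hx : x ∈ T) (n : ℕ) :
    privPart T x ∩ F n = x ∩ F n := by
  ext p
  constructor
  · rintro ⟨h1, h2⟩
    exact ⟨h1.1, h2⟩
  · rintro ⟨h1, h2⟩
    exact ⟨⟨h1, fun y hy hpy => h.2.1 n p h2 y hy x hx hpy h1⟩, h2⟩

theorem rest_inter {S : Set (Set Ω)} {F : ℕ → Set Ω} {T : Finset (Set Ω)}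
    (h : StepInv S F T) (n : ℕ) :
    restPart T ∩ F n = F n \ ⋃₀ (↑T : Set (Set Ω)) := by
  ext p
  constructor
  · rintro ⟨h1, h2⟩
    refine ⟨h2, ?_⟩
    rintro ⟨x, hx, hpx⟩
    have hx' : x ∈ T := by simpa using hx
    have : p ∈ privPart T x ∩ F n := by
      rw [priv_inter h hx']
      exact ⟨hpx, h2⟩
    exact h1 x hx' this.1
  · rintro ⟨h1, h2⟩
    exact ⟨fun x hx hp => h2 ⟨x, by simpa using hx, hp.1⟩, h1⟩

theorem partOf_colours {S : Set (Set Ω)} {F : ℕ → Set Ω} {T : Finset (Set Ω)}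
    (h : StepInv S F T) : Colours (partOf T) F := by
  intro c hc
  simp only [partOf, Finset.mem_insert, Finset.mem_image] at hc
  rcases hc with rfl | ⟨x, hx, rfl⟩
  · simp only [rest_inter h]
    exact h.2.2.2
  · simp only [priv_inter h hx]
    exact h.2.2.1 x hx

theorem step_lemma {S : Set (Set Ω)} {E F : ℕ → Set Ω} {T : Finset (Set Ω)}
    (hF : Refines F E) (h : StepInv S F T) (hnd : ¬ Decisive S (partOf T) F) :
    ∃ F' : ℕ → Set Ω, ∃ T' : Finset (Set Ω), Refines F' E ∧ StepInv S F' T' ∧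
      T'.card = T.card + 1 := by
  obtain ⟨⟨hfin, hne, hdis, hcard⟩, g, hg, hFE⟩ := hF
  have hrest : restPart T ∈ partOf T := by simp [partOf]
  have hpriv : ∀ x ∈ T, privPart T x ∈ partOf T := fun x hx => by
    simp only [partOf, Finset.mem_insert, Finset.mem_image]
    exact Or.inr ⟨x, hx, rfl⟩
  unfold Decisive at hnd
  push Not at hnd
  obtain ⟨z, hzS, hz⟩ := hnd _ hrest
  have hfreq : ∀ B : ℕ, ∃ᶠ n in atTop, B < (z ∩ restPart T ∩ F n).ncard ∧
      ∀ c ∈ partOf T, B < (zᶜ ∩ c ∩ F n).ncard := by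
    intro B
    rw [frequently_atTop]
    intro M
    obtain ⟨n, hn1, hn2⟩ := hz (max B ((Finset.range M).sup fun n => (F n).ncard))
    refine ⟨n, ?_, lt_of_le_of_lt (le_max_left _ _) hn1,
      fun c hc => lt_of_le_of_lt (le_max_left _ _) (hn2 c hc)⟩
    by_contra hlt
    have h1 : (F n).ncard ≤ (Finset.range M).sup fun n => (F n).ncard :=
      Finset.le_sup (f := fun n => (F n).ncard) (Finset.mem_range.mpr (by omega))
    have h2 : (z ∩ restPart T ∩ F n).ncard ≤ (F n).ncard :=
      ncard_le_ncard inter_subset_right (hfin n)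
    have h3 := le_max_right B ((Finset.range M).sup fun n => (F n).ncard)
    omega
  obtain ⟨φ, hφ, hP⟩ := extraction_forall_of_frequently hfreq
  let U : Set Ω := ⋃₀ (↑T : Set (Set Ω))
  let F' : ℕ → Set Ω := fun k => F (φ k) \ (z ∩ U)
  have hF'sub : ∀ k, F' k ⊆ F (φ k) := fun k => sdiff_subset
  have hF'fin : ∀ k, (F' k).Finite := fun k => (hfin _).subset (hF'sub k)
  have hr : ∀ k, ∀ p, p ∈ restPart T → p ∈ F (φ k) → p ∉ U := by
    intro k p h1 h2
    have : p ∈ restPart T ∩ F (φ k) := ⟨h1, h2⟩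
    rw [rest_inter h] at this
    exact this.2
  have hzbig : ∀ k, k < (z ∩ F' k).ncard := fun k => by
    refine (hP k).1.trans_le (ncard_le_ncard ?_ ((hF'fin k).subset inter_subset_right))
    rintro p ⟨⟨h1, h2⟩, h3⟩
    exact ⟨h1, h3, fun h4 => hr k p h2 h3 h4.2⟩
  have hxbig : ∀ x ∈ T, ∀ k, k < (x ∩ F' k).ncard := fun x hx k => by
    refine ((hP k).2 _ (hpriv x hx)).trans_le
      (ncard_le_ncard ?_ ((hF'fin k).subset inter_subset_right))
    rintro p ⟨⟨h1, h2⟩, h3⟩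
    exact ⟨h2.1, h3, fun h4 => h1 h4.1⟩
  have hcbig : ∀ k, k < (F' k \ ⋃₀ (insert z (↑T : Set (Set Ω)))).ncard := fun k => by
    refine ((hP k).2 _ hrest).trans_le
      (ncard_le_ncard ?_ ((hF'fin k).subset sdiff_subset))
    rintro p ⟨⟨h1, h2⟩, h3⟩
    refine ⟨⟨h3, fun h4 => h1 h4.1⟩, ?_⟩
    rintro ⟨y, hy, hpy⟩
    rcases hy with rfl | hy
    · exact h1 hpy
    · exact hr k p h2 h3 ⟨y, hy, hpy⟩
  have hFbig : ∀ k, k < (F' k).ncard := fun k =>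
    (hzbig k).trans_le (ncard_le_ncard inter_subset_right (hF'fin k))
  have hzT : z ∉ T := by
    intro hzT
    obtain ⟨p, ⟨h1, h2⟩, h3⟩ := nonempty_of_ncard_ne_zero
      (s := z ∩ restPart T ∩ F (φ 0)) (by have := (hP 0).1; omega)
    exact hr 0 p h2 h3 ⟨z, by simpa using hzT, h1⟩
  refine ⟨F', insert z T, ⟨⟨hF'fin, ?_, ?_, tendsto_of_lt _ hFbig⟩, g ∘ φ,
    hg.comp hφ.injective, fun j => (hF'sub j).trans (hFE _)⟩, ⟨?_, ?_, ?_, ?_⟩,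
    Finset.card_insert_of_notMem hzT⟩
  · intro n
    exact nonempty_of_ncard_ne_zero (by have := hFbig n; omega)
  · intro m n hmn
    exact (hdis _ _ (hφ.injective.ne hmn)).mono (hF'sub m) (hF'sub n)
  · intro y hy
    rw [Finset.coe_insert] at hy
    rcases hy with rfl | hy
    · exact hzS
    · exact h.1 hy
  · intro n p hp x hx y hy hpx hpy
    rw [Finset.mem_insert] at hx hy
    rcases hx with rfl | hx
    · rcases hy with rfl | hy
      · rfl
      · exact absurd ⟨hpx, y, by simpa using hy, hpy⟩ hp.2
    · rcases hy with rfl | hy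
      · exact absurd ⟨hpy, x, by simpa using hx, hpx⟩ hp.2
      · exact h.2.1 (φ n) p hp.1 x hx y hy hpx hpy
  · intro x hx
    rw [Finset.mem_insert] at hx
    rcases hx with rfl | hx
    · exact tendsto_of_lt _ hzbig
    · exact tendsto_of_lt _ (hxbig x hx)
  · rw [Finset.coe_insert]
    exact tendsto_of_lt _ hcbig

/-- A set system with finite breadth always admits a decisive colouring on a refinement. -/
theorem stmt10 {Ω : Type*} (S : Set (Set Ω)) (hS : UnionClosed S)
    (hb : FiniteBreadth S) (E : ℕ → Set Ω) (hE : IsSpread E) :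
    ∃ F : ℕ → Set Ω, Refines F E ∧
      ∃ C : Finset (Set Ω), IsPartitionC C ∧ Colours C F ∧ Decisive S C F := by
  by_contra hno
  have key : ∀ k : ℕ, ∃ F : ℕ → Set Ω, ∃ T : Finset (Set Ω), Refines F E ∧ StepInv S F T ∧
      T.card = k := by
    intro k
    induction k with
    | zero =>
      refine ⟨E, ∅, ⟨hE, id, Function.injective_id, fun j => subset_rfl⟩, ⟨?_, ?_, ?_, ?_⟩, rfl⟩
      · simp
      · simp
      · simp
      · simpa using hE.2.2.2
    | succ k ih =>
      obtain ⟨F, T, hF, hT, hk⟩ := ih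
      obtain ⟨F', T', hF', hT', hk'⟩ := step_lemma hF hT fun hd =>
        hno ⟨F, hF, partOf T, partOf_isPartition T, partOf_colours hT, hd⟩
      exact ⟨F', T', hF', hT', by omega⟩
  obtain ⟨N, hN⟩ := hb
  obtain ⟨F, T, _, hT, hk⟩ := key (N + 1)
  have := hN T hT.1 (stepInv_incompressible hT)
  omega
end

section
/- Let S be a semilattice with infinite breadth. Then at least one of the following holds: (i) there exist a set Ω and a concrete representation 𝒮 of S on Ω such that for every countable union-closed set system Q on ℕ there is an injective sequence (γ_k)_{k≥1} of elements of Ω with the property that for every c ∈ Q there exists x ∈ 𝒮 with x ∩ {γ_k : k ≥ 1} = {γ_k : k ∈ c}; or (ii) for every set Ω and every concrete representation 𝒮 of S on Ω, there exist a spread ℰ in Ω and a finite partition 𝒞 of Ω colouring ℰ which is 𝒮-decisive, such that 𝒮 ⊓ join(ℰ) contains T_max(ℰ), T_min(ℰ), or T_ort(ℰ). -/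
open Set Filter
open scoped Classical

variable {Ω : Type*}

universe u v


/-- A clique of pairs (point, set). -/
def Clq (T : Set (Set Ω)) (G : Finset (Ω × Set Ω)) : Prop :=
  (∀ p ∈ G, p.2 ∈ T ∧ p.1 ∈ p.2) ∧ ∀ p ∈ G, ∀ q ∈ G, p ≠ q → p.1 ∉ q.2

def Good (T : Set (Set Ω)) (E : ℕ → Set Ω) : Prop :=
  IsSpread E ∧ (Tmax E ⊆ proj T (sjoin E) ∨ Tmin E ⊆ proj T (sjoin E) ∨
              Tort E ⊆ proj T (sjoin E))

def BigP (T : Set (Set Ω)) (A : Set (Ω × Set Ω)) : Prop :=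
  ∀ k : ℕ, ∃ G : Finset (Ω × Set Ω), k ≤ G.card ∧ Clq T G ∧ ↑G ⊆ A

theorem Clq.mono {T : Set (Set Ω)} {G H : Finset (Ω × Set Ω)} (h : Clq T G) (hs : H ⊆ G) :
    Clq T H :=
  ⟨fun p hp => h.1 p (hs hp), fun p hp q hq => h.2 p (hs hp) q (hs hq)⟩

theorem BigP.union {T : Set (Set Ω)} {A B : Set (Ω × Set Ω)} (h : BigP T (A ∪ B)) :
    BigP T A ∨ BigP T B := by
  by_contra hc
  push Not at hc
  obtain ⟨hA, hB⟩ := hc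
  unfold BigP at hA hB
  push Not at hA hB
  obtain ⟨a, ha⟩ := hA
  obtain ⟨b, hb⟩ := hB
  obtain ⟨G, hG, hc, hs⟩ := h (a + b)
  have h1 := Finset.card_filter_add_card_filter_not (s := G) (fun p => p ∈ A)
  by_cases h2 : a ≤ (G.filter (fun p => p ∈ A)).card
  · refine ha _ h2 (hc.mono (Finset.filter_subset _ _)) ?_
    intro p hp
    simp at hp
    exact hp.2
  · refine hb (G.filter (fun p => ¬ p ∈ A)) (by omega) (hc.mono (Finset.filter_subset _ _)) ?_
    intro p hp
    simp at hp
    exact (hs hp.1).resolve_left hp.2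

theorem exists_ultra_s12 (T : Set (Set Ω)) (h : BigP T univ) :
    ∃ W : Ultrafilter (Ω × Set Ω), ∀ A ∈ W, BigP T A := by
  let L : Filter (Ω × Set Ω) :=
    { sets := {A | ¬ BigP T Aᶜ}
      univ_sets := by
        intro hb
        obtain ⟨G, h1, h2, h3⟩ := hb 1
        have : G.Nonempty := Finset.card_pos.1 h1
        obtain ⟨p, hp⟩ := this
        have := h3 hp
        simp at this
      sets_of_superset := by
        intro A B hA hAB hB
        apply hA
        intro k
        obtain ⟨G, h1, h2, h3⟩ := hB k
        exact ⟨G, h1, h2, h3.trans (compl_subset_compl.2 hAB)⟩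
      inter_sets := by
        intro A B hA hB h
        simp only [compl_inter] at h
        rcases h.union with h | h
        · exact hA h
        · exact hB h }
  have hL : L.NeBot := by
    refine ⟨fun hb => ?_⟩
    have : (∅ : Set (Ω × Set Ω)) ∈ L := by rw [hb]; exact Filter.mem_bot
    exact this (by simpa using h)
  refine ⟨Ultrafilter.of L, fun A hA => ?_⟩
  by_contra hb
  have h1 : Aᶜ ∈ L := by
    show ¬ BigP T Aᶜᶜ
    simpa using hb
  have h2 : Aᶜ ∈ Ultrafilter.of L := Ultrafilter.of_le L h1
  exact (Ultrafilter.compl_mem_iff_notMem.1 h2) hA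

theorem ultra_dec (W : Ultrafilter Ω) (R : Ω → Ω → Prop) :
    ∃ b : Prop, ∀ᶠ p in W, ∀ᶠ q in W, (R p q ↔ b) := by
  by_cases h : ∀ᶠ p in W, ∀ᶠ q in W, R p q
  · refine ⟨True, ?_⟩
    simpa using h
  · refine ⟨False, ?_⟩
    rw [← Ultrafilter.eventually_not] at h
    filter_upwards [h] with p hp
    rw [← Ultrafilter.eventually_not] at hp
    simpa using hp

theorem biUnion_mem {T : Set (Set Ω)} (hT : UnionClosed T) (G : Finset (Ω × Set Ω))
    (hne : G.Nonempty) (h : ∀ p ∈ G, p.2 ∈ T) : (⋃ p ∈ G, p.2) ∈ T := by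
  induction hne using Finset.Nonempty.cons_induction with
  | singleton a => simpa using h
  | cons a s ha hs ih =>
    rw [Finset.cons_eq_insert] at h ⊢
    rw [Finset.set_biUnion_insert]
    apply hT
    · exact h a (by simp)
    · exact ih (fun p hp => h p (by simp [hp]))

set_option maxHeartbeats 2000000 in
theorem exists_good_s12 (T : Set (Set Ω)) (hT : UnionClosed T) (hb : BigP T univ) :
    ∃ E, Good T E := by
  obtain ⟨W, hW⟩ := exists_ultra_s12 T hb
  obtain ⟨ε, hε⟩ := ultra_dec W (fun p q => q.1 ∈ p.2)
  obtain ⟨δ, hδ⟩ := ultra_dec W (fun p q => p.1 ∈ q.2)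
  have hne : ∀ p : Ω × Set Ω, ∀ᶠ q : Ω × Set Ω in W, p.1 ≠ q.1 := by
    intro p
    by_contra hc
    rw [← Ultrafilter.eventually_not] at hc
    obtain ⟨G, h1, h2, h3⟩ := hW _ hc 2
    obtain ⟨a, ha, b, hb, hab⟩ := Finset.one_lt_card.1 h1
    have e1 := h3 ha
    have e2 := h3 hb
    simp at e1 e2
    have := h2.2 a ha b hb hab
    rw [← e1, e2] at this
    exact this (h2.1 b hb).2
  have key : ∀ᶠ p : Ω × Set Ω in W, ∀ᶠ q : Ω × Set Ω in W,
      ((q.1 ∈ p.2 ↔ ε) ∧ (p.1 ∈ q.2 ↔ δ) ∧ p.1 ≠ q.1) := by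
    filter_upwards [hε, hδ] with p h1 h2
    filter_upwards [h1, h2, hne p] with q a b c
    exact ⟨a, b, c⟩
  obtain ⟨P, hP, hr⟩ := exists_seq_of_forall_finset_exists
    (fun G : Finset (Ω × Set Ω) => G.Nonempty ∧ Clq T G ∧ ∀ p ∈ G, ∀ᶠ q : Ω × Set Ω in W,
      ((q.1 ∈ p.2 ↔ ε) ∧ (p.1 ∈ q.2 ↔ δ) ∧ p.1 ≠ q.1))
    (fun G H => G.card < H.card ∧ ∀ p ∈ G, ∀ q ∈ H,
      ((q.1 ∈ p.2 ↔ ε) ∧ (p.1 ∈ q.2 ↔ δ) ∧ p.1 ≠ q.1)) (by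
    intro s hs
    have h1 : ∀ᶠ q : Ω × Set Ω in W, ∀ G ∈ s, ∀ p ∈ G,
        ((q.1 ∈ p.2 ↔ ε) ∧ (p.1 ∈ q.2 ↔ δ) ∧ p.1 ≠ q.1) := by
      rw [Filter.eventually_all_finset]
      intro G hG
      rw [Filter.eventually_all_finset]
      exact (hs G hG).2.2
    obtain ⟨H, c1, c2, c3⟩ := hW _ (h1.and key) (∑ G ∈ s, G.card + 1)
    refine ⟨H, ⟨Finset.card_pos.1 (by omega), c2, fun p hp => (c3 hp).2⟩, fun G hG => ⟨?_, ?_⟩⟩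
    · have := Finset.single_le_sum (f := fun G : Finset (Ω × Set Ω) => G.card)
        (fun _ _ => Nat.zero_le _) hG
      omega
    · intro p hp q hq
      exact (c3 hq).1 G hG p hp)
  let E : ℕ → Set Ω := fun n => Prod.fst '' (P n : Set (Ω × Set Ω))
  have hcard : ∀ n, (E n).ncard = (P n).card := by
    intro n
    rw [Set.ncard_image_of_injOn, Set.ncard_coe_finset]
    intro p hp q hq hpq
    by_contra hne
    have := (hP n).2.1.2 p hp q hq hne
    rw [hpq] at this
    exact this ((hP n).2.1.1 q hq).2
  refine ⟨E, ⟨fun n => (Finset.finite_toSet _).image _, fun n => ?_, ?_, ?_⟩, ?_⟩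
  · exact (Finset.coe_nonempty.2 (hP n).1).image _
  · have : ∀ m n, m < n → Disjoint (E m) (E n) := by
      intro m n hmn
      rw [Set.disjoint_left]
      rintro z ⟨p, hp, rfl⟩ ⟨q, hq, h⟩
      exact ((hr m n hmn).2 p hp q hq).2.2 h.symm
    intro m n hmn
    rcases lt_or_gt_of_ne hmn with h | h
    · exact this m n h
    · exact (this n m h).symm
  · simp only [hcard]
    apply StrictMono.tendsto_atTop
    intro m n hmn
    exact (hr m n hmn).1
  -- the membership rule
  have rule : ∀ m n, ∀ p ∈ P m, ∀ q ∈ P n, (q.1 ∈ p.2 ↔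
      ((m < n ∧ ε) ∨ (n < m ∧ δ) ∨ p = q)) := by
    intro m n p hp q hq
    have hmem := ((hP n).2.1.1 q hq).2
    rcases lt_trichotomy m n with h | h | h
    · have h1 := (hr m n h).2 p hp q hq
      have : p ≠ q := fun e => h1.2.2 (by rw [e])
      have h' : ¬ n < m := by omega
      simp [h, h', this, h1.1]
    · subst h
      by_cases hpq : p = q
      · subst hpq; simpa using hmem
      · have := (hP m).2.1.2 q hq p hp (Ne.symm hpq)
        simp [hpq, this]
    · have h1 := (hr n m h).2 q hq p hp
      have : p ≠ q := fun e => h1.2.2 (by rw [e])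
      have h' : ¬ m < n := by omega
      simp [h, h', this, h1.2.1]
  have inj : ∀ m n, ∀ p ∈ P m, ∀ q ∈ P n, p.1 = q.1 → p = q := by
    intro m n p hp q hq h
    rcases lt_trichotomy m n with h' | h' | h'
    · exact absurd h ((hr m n h').2 p hp q hq).2.2
    · subst h'
      by_contra hpq
      have := (hP m).2.1.2 p hp q hq hpq
      rw [h] at this
      exact this ((hP m).2.1.1 q hq).2
    · exact absurd h.symm ((hr n m h').2 q hq p hp).2.2
  have lev : ∀ m n, ∀ p ∈ P m, p ∈ P n → m = n := by
    intro m n p hp hq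
    rcases lt_trichotomy m n with h' | h' | h'
    · exact absurd rfl ((hr m n h').2 p hp p hq).2.2
    · exact h'
    · exact absurd rfl ((hr n m h').2 p hq p hp).2.2
  have memE : ∀ n k, ∀ q ∈ P n, (q.1 ∈ E k ↔ k = n) := by
    intro n k q hq
    constructor
    · rintro ⟨p, hp, h⟩
      have := inj k n p hp q hq h
      subst this
      exact lev _ _ _ hp hq
    · rintro rfl
      exact ⟨q, hq, rfl⟩
  -- general unions over a finite set
  have main : ∀ n (a : Set Ω), a ⊆ E n → a.Nonempty →
      ∃ y ∈ T, ∀ m, ∀ q ∈ P m, (q.1 ∈ y ↔ (n < m ∧ ε) ∨ (m < n ∧ δ) ∨ q.1 ∈ a) := by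
    intro n a ha hane
    refine ⟨⋃ p ∈ (P n).filter (fun p => p.1 ∈ a), p.2, biUnion_mem hT _ ?_ ?_, ?_⟩
    · obtain ⟨z, hz⟩ := hane
      obtain ⟨p, hp, rfl⟩ := ha hz
      exact ⟨p, by simp [hz]; exact hp⟩
    · intro p hp
      exact ((hP n).2.1.1 p (Finset.mem_filter.1 hp).1).1
    · intro m q hq
      simp only [mem_iUnion, Finset.mem_filter, exists_prop]
      constructor
      · rintro ⟨p, ⟨hp, hpa⟩, hqp⟩
        rw [rule n m p hp q hq] at hqp
        rcases hqp with h | h | h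
        · exact Or.inl h
        · exact Or.inr (Or.inl h)
        · subst h; exact Or.inr (Or.inr hpa)
      · rintro (h | h | h)
        · obtain ⟨z, hz⟩ := hane
          obtain ⟨p, hp, rfl⟩ := ha hz
          exact ⟨p, ⟨hp, hz⟩, (rule n m p hp q hq).2 (Or.inl h)⟩
        · obtain ⟨z, hz⟩ := hane
          obtain ⟨p, hp, rfl⟩ := ha hz
          exact ⟨p, ⟨hp, hz⟩, (rule n m p hp q hq).2 (Or.inr (Or.inl h))⟩
        · have : m = n := ((memE m n q hq).1 (ha h)).symm
          subst this
          exact ⟨q, ⟨hq, h⟩, ((hP _).2.1.1 q hq).2⟩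
  have hproj : ∀ x : Set Ω, x ⊆ sjoin E → (∃ y ∈ T, ∀ m, ∀ q ∈ P m, (q.1 ∈ y ↔ q.1 ∈ x)) →
      x ∈ proj T (sjoin E) := by
    rintro x hx ⟨y, hy, h⟩
    refine ⟨y, hy, ?_⟩
    ext z
    constructor
    · rintro ⟨h1, h2⟩
      obtain ⟨m, q, hq, rfl⟩ := mem_iUnion.1 h2
      exact (h m q hq).1 h1
    · intro hz
      have h2 := hx hz
      obtain ⟨m, q, hq, rfl⟩ := mem_iUnion.1 h2
      exact ⟨(h m q hq).2 hz, h2⟩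
  have subj : ∀ k, E k ⊆ sjoin E := fun k => subset_iUnion E k
  have subj2 : ∀ (Q : ℕ → Prop), (⋃ k, ⋃ (_ : Q k), E k) ⊆ sjoin E := fun Q =>
    iUnion_subset fun k => iUnion_subset fun _ => subj k
  have memlt : ∀ n m, ∀ q ∈ P m, (q.1 ∈ (⋃ k < n, E k) ↔ m < n) := by
    intro n m q hq
    simp only [mem_iUnion, memE m _ q hq, exists_prop]
    constructor
    · rintro ⟨i, h, rfl⟩; exact h
    · intro h; exact ⟨m, h, rfl⟩
  have memgt : ∀ n m, ∀ q ∈ P m, (q.1 ∈ (⋃ k > n, E k) ↔ n < m) := by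
    intro n m q hq
    simp only [mem_iUnion, memE m _ q hq, exists_prop]
    constructor
    · rintro ⟨i, h, rfl⟩; exact h
    · intro h; exact ⟨m, h, rfl⟩
  by_cases hε' : ε
  · by_cases hδ' : δ
    · right; right
      rintro x ⟨n, a, ha, hane, rfl⟩
      apply hproj
      · exact union_subset (union_subset (subj2 _) (ha.trans (subj n))) (subj2 _)
      obtain ⟨y, hy, h⟩ := main n a ha hane
      refine ⟨y, hy, fun m q hq => ?_⟩
      rw [h m q hq, mem_union, mem_union, memlt n m q hq, memgt n m q hq]
      tauto
    · right; left
      rintro x ⟨n, a, ha, hane, rfl⟩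
      apply hproj
      · exact union_subset (ha.trans (subj n)) (subj2 _)
      obtain ⟨y, hy, h⟩ := main n a ha hane
      refine ⟨y, hy, fun m q hq => ?_⟩
      rw [h m q hq, mem_union, memgt n m q hq]
      tauto
  · left
    by_cases hδ' : δ
    · rintro x ⟨n, a, ha, hane, rfl⟩
      apply hproj
      · exact union_subset (subj2 _) (ha.trans (subj n))
      obtain ⟨y, hy, h⟩ := main n a ha hane
      refine ⟨y, hy, fun m q hq => ?_⟩
      rw [h m q hq, mem_union, memlt n m q hq]
      tauto
    · have main2 : ∀ n, ∀ y ∈ T, ∃ z ∈ T, ∀ m, ∀ q ∈ P m, (q.1 ∈ z ↔ m < n ∨ q.1 ∈ y) := by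
        intro n y hy
        induction n with
        | zero => exact ⟨y, hy, by simp⟩
        | succ n ih =>
          obtain ⟨z, hz, h⟩ := ih
          have hEn : (E n).Nonempty := (Finset.coe_nonempty.2 (hP n).1).image _
          obtain ⟨u, hu, h'⟩ := main n (E n) subset_rfl hEn
          refine ⟨u ∪ z, hT _ hu _ hz, fun m q hq => ?_⟩
          rw [mem_union, h m q hq, h' m q hq, memE m n q hq]
          have : m < n + 1 ↔ m < n ∨ n = m := by omega
          tauto
      rintro x ⟨n, a, ha, hane, rfl⟩
      apply hproj
      · exact union_subset (subj2 _) (ha.trans (subj n))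
      obtain ⟨y, hy, h⟩ := main n a ha hane
      obtain ⟨z, hz, h'⟩ := main2 n y hy
      refine ⟨z, hz, fun m q hq => ?_⟩
      rw [h' m q hq, h m q hq, mem_union, memlt n m q hq]
      tauto

theorem Good.refine {T : Set (Set Ω)} {E : ℕ → Set Ω} (h : Good T E) (F : ℕ → Set Ω)
    (g : ℕ → ℕ) (hg : StrictMono g) (hF : ∀ j, F j ⊆ E (g j)) (hne : ∀ j, (F j).Nonempty)
    (ht : Tendsto (fun n => (F n).ncard) atTop atTop) : Good T F := by
  obtain ⟨⟨h1, h2, h3, h4⟩, h5⟩ := h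
  have uniq : ∀ z m n, z ∈ E m → z ∈ E n → m = n := by
    intro z m n hm hn
    by_contra hc
    exact Set.disjoint_left.1 (h3 m n hc) hm hn
  have uniqF : ∀ z m n, z ∈ F m → z ∈ E (g n) → m = n := by
    intro z m n hm hn
    exact hg.injective (uniq z _ _ (hF _ hm) hn)
  have lev : ∀ z j k, z ∈ F j → (z ∈ E k ↔ k = g j) := by
    intro z j k hz
    exact ⟨fun h => uniq z _ _ h (hF j hz), fun h => h ▸ hF j hz⟩
  have levF : ∀ z j k, z ∈ F j → (z ∈ F k ↔ k = j) := by
    intro z j k hz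
    exact ⟨fun h => uniqF z _ _ h (hF j hz), fun h => h ▸ hz⟩
  have hj : sjoin F ⊆ sjoin E := by
    intro z hz
    obtain ⟨j, hj⟩ := mem_iUnion.1 hz
    exact mem_iUnion.2 ⟨_, hF j hj⟩
  have hproj : ∀ x y : Set Ω, y ∈ proj T (sjoin E) → x ⊆ sjoin F →
      (∀ j, ∀ z ∈ F j, (z ∈ y ↔ z ∈ x)) → x ∈ proj T (sjoin F) := by
    rintro x y ⟨t, ht, rfl⟩ hx h
    refine ⟨t, ht, ?_⟩
    ext z
    constructor
    · rintro ⟨a, b⟩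
      obtain ⟨j, hz⟩ := mem_iUnion.1 b
      exact (h j z hz).1 ⟨a, hj b⟩
    · intro hz
      have b := hx hz
      obtain ⟨j, hz'⟩ := mem_iUnion.1 b
      exact ⟨((h j z hz').2 hz).1, b⟩
  have subj : ∀ k, F k ⊆ sjoin F := fun k => subset_iUnion F k
  have subj2 : ∀ (Q : ℕ → Prop), (⋃ k, ⋃ (_ : Q k), F k) ⊆ sjoin F := fun Q =>
    iUnion_subset fun k => iUnion_subset fun _ => subj k
  have memlt : ∀ n j, ∀ z ∈ F j, (z ∈ (⋃ k < g n, E k) ↔ z ∈ (⋃ k < n, F k)) := by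
    intro n j z hz
    simp only [mem_iUnion, lev z j _ hz, levF z j _ hz, exists_prop]
    simp [hg.lt_iff_lt]
  have memgt : ∀ n j, ∀ z ∈ F j, (z ∈ (⋃ k > g n, E k) ↔ z ∈ (⋃ k > n, F k)) := by
    intro n j z hz
    simp only [mem_iUnion, lev z j _ hz, levF z j _ hz, exists_prop]
    simp [hg.lt_iff_lt]
  refine ⟨⟨fun n => (h1 _).subset (hF n), hne, ?_, ht⟩, ?_⟩
  · intro m n hmn
    exact (h3 _ _ (hg.injective.ne hmn)).mono (hF m) (hF n)
  rcases h5 with h5 | h5 | h5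
  · left
    rintro x ⟨n, a, ha, hane, rfl⟩
    refine hproj _ _ (h5 ⟨g n, a, ha.trans (hF n), hane, rfl⟩)
      (union_subset (subj2 _) (ha.trans (subj n))) ?_
    intro j z hz
    rw [mem_union, mem_union, memlt n j z hz]
  · right; left
    rintro x ⟨n, a, ha, hane, rfl⟩
    refine hproj _ _ (h5 ⟨g n, a, ha.trans (hF n), hane, rfl⟩)
      (union_subset (ha.trans (subj n)) (subj2 _)) ?_
    intro j z hz
    rw [mem_union, mem_union, memgt n j z hz]
  · right; right
    rintro x ⟨n, a, ha, hane, rfl⟩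
    refine hproj _ _ (h5 ⟨g n, a, ha.trans (hF n), hane, rfl⟩)
      (union_subset (union_subset (subj2 _) (ha.trans (subj n))) (subj2 _)) ?_
    intro j z hz
    rw [mem_union, mem_union, mem_union, mem_union, memgt n j z hz, memlt n j z hz]

/-- The private part of `x` in `F`. -/
def priv (F : Finset (Set Ω)) (x : Set Ω) : Set Ω := {z | z ∈ x ∧ ∀ y ∈ F, y ≠ x → z ∉ y}

def outer (F : Finset (Set Ω)) : Set Ω := {z | ∀ y ∈ F, z ∉ y}

def State (T : Set (Set Ω)) (F : Finset (Set Ω)) : Prop :=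
  ↑F ⊆ T ∧ ∃ E, Good T E ∧ (∀ x ∈ F, Tendsto (fun n => (priv F x ∩ E n).ncard) atTop atTop) ∧
    Tendsto (fun n => (outer F ∩ E n).ncard) atTop atTop

theorem state_step (T : Set (Set Ω))
    (hdec : ∀ E, Good T E → ∀ C, IsPartitionC C → Colours C E → ¬ Decisive T C E)
    (F : Finset (Set Ω)) (hF : State T F) : ∃ F', F ⊂ F' ∧ State T F' := by
  obtain ⟨hFT, E, hE, hp, ho⟩ := hF
  set c₀ : Set Ω := (⋃ x ∈ F, priv F x)ᶜ with hc₀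
  set U : Set Ω := c₀ᶜ ∪ outer F with hU
  have fin : ∀ n, (E n).Finite := hE.1.1
  have outsub : outer F ⊆ c₀ := by
    intro z hz
    simp only [hc₀, mem_compl_iff, mem_iUnion, not_exists]
    intro x hx h
    exact hz x hx h.1
  have privsub : ∀ x ∈ F, priv F x ⊆ U := by
    intro x hx z hz
    left
    simp only [hc₀, compl_compl, mem_iUnion]
    exact ⟨x, hx, hz⟩
  have c0U : c₀ ∩ U ⊆ outer F := by
    rintro z ⟨h1, h2 | h2⟩
    · exact absurd h1 h2
    · exact h2
  obtain ⟨N, hN⟩ := (tendsto_atTop_atTop.1 ho) 1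
  set E1 : ℕ → Set Ω := fun n => U ∩ E (n + N) with hE1
  have fin1 : ∀ n, (E1 n).Finite := fun n => (fin _).subset inter_subset_right
  have ho' := (tendsto_add_atTop_iff_nat N).2 ho
  have hE1g : Good T E1 := by
    refine hE.refine E1 (fun n => n + N) (fun a b h => by simpa using h)
      (fun j => inter_subset_right) ?_ ?_
    · intro j
      have h1 := hN (j + N) (by omega)
      have : (outer F ∩ E (j + N)).Nonempty := by
        rw [← Set.ncard_pos ((fin _).subset inter_subset_right)]; omega
      exact this.mono (inter_subset_inter_left _ subset_union_right)
    · refine tendsto_atTop_mono (fun n => ?_) ho'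
      exact Set.ncard_le_ncard (inter_subset_inter_left _ subset_union_right) (fin1 n)
  set C : Finset (Set Ω) := insert c₀ (F.image (priv F)) with hC
  have hpart : IsPartitionC C := by
    have d0 : ∀ x ∈ F, Disjoint c₀ (priv F x) := by
      intro x hx
      rw [Set.disjoint_left]
      intro z hz hz'
      exact hz (mem_iUnion₂.2 ⟨x, hx, hz'⟩)
    have d1 : ∀ x ∈ F, ∀ y ∈ F, priv F x ≠ priv F y → Disjoint (priv F x) (priv F y) := by
      intro x hx y hy hxy
      rw [Set.disjoint_left]
      intro z hz hz'
      have : x ≠ y := fun h => hxy (by rw [h])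
      exact hz.2 y hy this.symm hz'.1
    constructor
    · intro c hc d hd hcd
      simp only [hC, Finset.mem_insert, Finset.mem_image] at hc hd
      rcases hc with rfl | ⟨x, hx, rfl⟩ <;> rcases hd with rfl | ⟨y, hy, rfl⟩
      · exact absurd rfl hcd
      · exact d0 y hy
      · exact (d0 x hx).symm
      · exact d1 x hx y hy hcd
    · rw [eq_univ_iff_forall]
      intro z
      by_cases hz : z ∈ c₀
      · exact ⟨c₀, by simp [hC], hz⟩
      · simp only [hc₀, mem_compl_iff, not_not, mem_iUnion] at hz
        obtain ⟨x, hx, hz⟩ := hz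
        exact ⟨priv F x, by
          rw [hC, Finset.mem_coe]
          exact Finset.mem_insert_of_mem (Finset.mem_image_of_mem _ hx), hz⟩
  have hcol : Colours C E1 := by
    intro c hc
    simp only [hC, Finset.mem_insert, Finset.mem_image] at hc
    rcases hc with rfl | ⟨x, hx, rfl⟩
    · refine tendsto_atTop_mono (fun n => ?_) ho'
      refine Set.ncard_le_ncard ?_ ((fin1 n).subset inter_subset_right)
      rintro z ⟨h1, h2⟩
      exact ⟨outsub h1, Or.inr h1, h2⟩
    · refine tendsto_atTop_mono (fun n => ?_) ((tendsto_add_atTop_iff_nat N).2 (hp x hx))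
      refine Set.ncard_le_ncard ?_ ((fin1 n).subset inter_subset_right)
      rintro z ⟨h1, h2⟩
      exact ⟨h1, privsub x hx h1, h2⟩
  have hnd := hdec E1 hE1g C hpart hcol
  unfold Decisive at hnd
  push Not at hnd
  obtain ⟨x, hxT, hx⟩ := hnd c₀ (by simp [hC])
  have hfreq : ∀ B, ∃ᶠ n in atTop, B < (x ∩ c₀ ∩ E1 n).ncard ∧
      ∀ c ∈ C, B < (xᶜ ∩ c ∩ E1 n).ncard := by
    intro B
    rw [Filter.frequently_atTop]
    intro M
    obtain ⟨n, h1, h2⟩ := hx (B + ∑ i ∈ Finset.range M, (E1 i).ncard)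
    refine ⟨n, ?_, by omega, fun c hc => by have := h2 c hc; omega⟩
    by_contra hlt
    have h3 := Finset.single_le_sum (f := fun i => (E1 i).ncard)
        (fun _ _ => Nat.zero_le _) (Finset.mem_range.2 (not_le.1 hlt))
    have h4 : (x ∩ c₀ ∩ E1 n).ncard ≤ (E1 n).ncard :=
      Set.ncard_le_ncard inter_subset_right (fin1 n)
    beta_reduce at h3
    omega
  obtain ⟨g, hg, hgP⟩ := Filter.extraction_forall_of_frequently hfreq
  have hxF : x ∉ F := by
    intro hxF
    have h1 := (hgP 0).1
    have : (x ∩ c₀ ∩ E1 (g 0)).Nonempty := by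
      rw [← Set.ncard_pos ((fin1 _).subset inter_subset_right)]; exact h1
    obtain ⟨z, ⟨h2, h3⟩, h4⟩ := this
    exact c0U ⟨h3, h4.1⟩ x hxF h2
  have tend : ∀ (A : Set Ω), (∀ j, j ≤ (A ∩ E1 (g j)).ncard) →
      Tendsto (fun n => (A ∩ E1 (g n)).ncard) atTop atTop :=
    fun A h => tendsto_atTop_mono h tendsto_id
  refine ⟨insert x F, Finset.ssubset_insert hxF, ?_, E1 ∘ g, ?_, ?_, ?_⟩
  · intro y hy
    simp only [Finset.coe_insert, mem_insert_iff] at hy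
    rcases hy with rfl | hy
    · exact hxT
    · exact hFT hy
  · exact hE1g.refine _ g hg (fun j => subset_rfl) (fun j => hE1g.1.2.1 _)
      (hE1g.1.2.2.2.comp hg.tendsto_atTop)
  · intro y hy
    apply tend
    intro j
    rcases Finset.mem_insert.1 hy with rfl | hy
    · refine (hgP j).1.le.trans (Set.ncard_le_ncard ?_ ((fin1 _).subset inter_subset_right))
      rintro z ⟨⟨h2, h3⟩, h4⟩
      refine ⟨⟨h2, ?_⟩, h4⟩
      intro w hw hwy
      exact c0U ⟨h3, h4.1⟩ w ((Finset.mem_insert.1 hw).resolve_left hwy)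
    · refine ((hgP j).2 (priv F y) (Finset.mem_insert_of_mem
        (Finset.mem_image_of_mem _ hy))).le.trans
        (Set.ncard_le_ncard ?_ ((fin1 _).subset inter_subset_right))
      rintro z ⟨⟨h2, h3⟩, h4⟩
      refine ⟨⟨h3.1, ?_⟩, h4⟩
      intro w hw hwy
      rcases Finset.mem_insert.1 hw with rfl | hw
      · exact h2
      · exact h3.2 w hw hwy
  · apply tend
    intro j
    refine ((hgP j).2 c₀ (Finset.mem_insert_self _ _)).le.trans
      (Set.ncard_le_ncard ?_ ((fin1 _).subset inter_subset_right))
    rintro z ⟨⟨h2, h3⟩, h4⟩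
    refine ⟨?_, h4⟩
    intro w hw
    rcases Finset.mem_insert.1 hw with rfl | hw
    · exact h2
    · exact c0U ⟨h3, h4.1⟩ w hw

theorem exists_indep (T : Set (Set Ω)) (E : ℕ → Set Ω) (hE : Good T E)
    (hdec : ∀ E, Good T E → ∀ C, IsPartitionC C → Colours C E → ¬ Decisive T C E) :
    ∃ s : ℕ → Set Ω, (∀ i, s i ∈ T) ∧
      ∀ i, ∀ J : Finset ℕ, i ∉ J → ¬ s i ⊆ ⋃ j ∈ J, s j := by
  have h0 : State T ∅ := by
    refine ⟨by simp, E, hE, by simp, ?_⟩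
    have : outer (∅ : Finset (Set Ω)) = univ := by ext; simp [outer]
    simpa [this] using hE.1.2.2.2
  choose nxt hn1 hn2 using state_step T hdec
  let st : ℕ → {F // State T F} := fun n => Nat.rec ⟨∅, h0⟩ (fun _ F => ⟨nxt F.1 F.2, hn2 _ _⟩) n
  have hst : StrictMono (fun n => (st n).1) := by
    apply strictMono_nat_of_lt_succ
    intro n
    exact hn1 (st n).1 (st n).2
  have hcard : StrictMono (fun n => (st n).1.card) := fun a b h => Finset.card_lt_card (hst h)
  let A : Set (Set Ω) := ⋃ n, ((st n).1 : Set (Set Ω))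
  have hA : A.Infinite := by
    intro hfin
    have h1 : (st (A.ncard + 1)).1.card ≤ A.ncard := by
      rw [← Set.ncard_coe_finset]
      refine Set.ncard_le_ncard ?_ hfin
      intro z hz
      exact mem_iUnion.2 ⟨A.ncard + 1, hz⟩
    have h2 := hcard.id_le (A.ncard + 1)
    simp only [id] at h2
    omega
  have := hA.to_subtype
  let e := Infinite.natEmbedding A
  refine ⟨fun i => (e i).1, ?_, ?_⟩
  · intro i
    obtain ⟨n, hn⟩ := mem_iUnion.1 (e i).2
    exact (st n).2.1 hn
  · intro i J hiJ hsub
    have hev : ∀ᶠ n in atTop, ∀ j ∈ insert i J, (e j).1 ∈ (st n).1 := by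
      rw [Filter.eventually_all_finset]
      intro j _
      obtain ⟨n, hn⟩ := mem_iUnion.1 (e j).2
      filter_upwards [eventually_ge_atTop n] with m hm
      exact hst.monotone hm hn
    obtain ⟨n, hn⟩ := hev.exists
    obtain ⟨-, E', hE', hp, -⟩ := (st n).2
    have h1 := hp _ (hn i (Finset.mem_insert_self _ _))
    obtain ⟨k, hk⟩ := (h1.eventually (eventually_ge_atTop 1)).exists
    have : (priv (st n).1 (e i).1 ∩ E' k).Nonempty := by
      rw [← Set.ncard_pos ((hE'.1.1 k).subset inter_subset_right)]; omega
    obtain ⟨z, hz, -⟩ := this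
    obtain ⟨j, hj, hzj⟩ := mem_iUnion₂.1 (hsub hz.1)
    refine hz.2 _ (hn j (Finset.mem_insert_of_mem hj)) ?_ hzj
    intro h
    have := e.injective (Subtype.ext h)
    subst this
    exact hiJ hj

theorem map_sup' {S : Type*} [SemilatticeSup S] {ι : Type*} (f : S → Set Ω)
    (hf : ∀ x y, f (x ⊔ y) = f x ∪ f y) (J : Finset ι) (hJ : J.Nonempty) (s : ι → S) :
    f (J.sup' hJ s) = ⋃ j ∈ J, f (s j) := by
  induction hJ using Finset.Nonempty.cons_induction with
  | singleton a => simp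
  | cons a t ha ht ih =>
    rw [Finset.sup'_cons ht, hf, ih, Finset.cons_eq_insert, Finset.set_biUnion_insert]

theorem f_mono {S : Type*} [SemilatticeSup S] (f : S → Set Ω)
    (hf : ∀ x y, f (x ⊔ y) = f x ∪ f y) {x y : S} (h : x ≤ y) : f x ⊆ f y := by
  rw [← sup_eq_right.2 h, hf]; exact subset_union_left

theorem big_of_breadth {S : Type*} [SemilatticeSup S]
    (hS : ∀ n : ℕ, ∃ E : Finset S, E.card = n ∧ AIncomp E)
    (f : S → Set Ω) (hinj : Function.Injective f)
    (hf : ∀ x y, f (x ⊔ y) = f x ∪ f y) : BigP (range f) univ := by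
  intro k
  obtain ⟨E, hE, hinc⟩ := hS (k + 2)
  have hne : E.Nonempty := Finset.card_pos.1 (by omega)
  have hw : ∀ x ∈ E, ∃ w, w ∈ f x ∧ ∀ y ∈ E, y ≠ x → w ∉ f y := by
    intro x hx
    by_contra hc
    push Not at hc
    have hne' : (E.erase x).Nonempty := by
      apply Finset.card_pos.1; rw [Finset.card_erase_of_mem hx]; omega
    apply hinc (E.erase x) (Finset.erase_ssubset hx) hne' hne
    apply hinj
    rw [map_sup' f hf, map_sup' f hf]
    ext z
    simp only [mem_iUnion, Finset.mem_erase, id, exists_prop]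
    constructor
    · rintro ⟨y, ⟨-, hy⟩, hz⟩
      exact ⟨y, hy, hz⟩
    · rintro ⟨y, hy, hz⟩
      by_cases h : y = x
      · subst h
        obtain ⟨y', h1, h2, h3⟩ := hc z hz
        exact ⟨y', ⟨h2, h1⟩, h3⟩
      · exact ⟨y, ⟨h, hy⟩, hz⟩
  have : Nonempty Ω := by
    obtain ⟨x0, hx0⟩ := hne
    obtain ⟨w0, -⟩ := hw x0 hx0
    exact ⟨w0⟩
  choose! w hw1 hw2 using hw
  refine ⟨E.image (fun x => (w x, f x)), ?_, ⟨?_, ?_⟩, subset_univ _⟩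
  · rw [Finset.card_image_of_injective]
    · omega
    · intro x y h
      exact hinj (Prod.mk.inj h).2
  · intro p hp
    obtain ⟨x, hx, rfl⟩ := Finset.mem_image.1 hp
    exact ⟨⟨x, rfl⟩, hw1 x hx⟩
  · intro p hp q hq hpq
    obtain ⟨x, hx, rfl⟩ := Finset.mem_image.1 hp
    obtain ⟨y, hy, rfl⟩ := Finset.mem_image.1 hq
    exact hw2 x hx y hy (fun h => hpq (by rw [h]))

theorem universal_of_indep {S : Type u} [SemilatticeSup S] (s : ℕ → S)
    (hs : ∀ i, ∀ J : Finset ℕ, ∀ hJ : J.Nonempty, i ∉ J → ¬ s i ≤ J.sup' hJ s) :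
    (∃ (Ω : Type u) (𝒮 : Set (Set Ω)) (f : S → Set Ω),
        Function.Injective f ∧ (∀ x y : S, f (x ⊔ y) = f x ∪ f y) ∧
        Set.range f = 𝒮 ∧
        ∀ Q : Set (Set ℕ), Q.Countable → UnionClosed Q →
          ∃ γ : ℕ → Ω, Function.Injective γ ∧
            ∀ c ∈ Q, ∃ x ∈ 𝒮, x ∩ Set.range γ = γ '' c) := by
  refine ⟨{I : Set S // IsLowerSet I ∧ ∀ x ∈ I, ∀ y ∈ I, x ⊔ y ∈ I}, _,
    fun x => {I | x ∉ I.1}, ?_, ?_, rfl, ?_⟩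
  · intro x y h
    have key : ∀ x y : S, {I : {I : Set S // IsLowerSet I ∧ ∀ x ∈ I, ∀ y ∈ I, x ⊔ y ∈ I} |
        x ∉ I.1} = {I | y ∉ I.1} → x ≤ y := by
      intro x y h
      by_contra hxy
      let I : {I : Set S // IsLowerSet I ∧ ∀ x ∈ I, ∀ y ∈ I, x ⊔ y ∈ I} :=
        ⟨Set.Iic y, isLowerSet_Iic y, fun a ha b hb => sup_le ha hb⟩
      have h1 : I ∈ {I : {I : Set S // IsLowerSet I ∧ ∀ x ∈ I, ∀ y ∈ I, x ⊔ y ∈ I} |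
        x ∉ I.1} := hxy
      rw [h] at h1
      exact h1 (le_refl y)
    exact le_antisymm (key x y h) (key y x h.symm)
  · intro x y
    ext I
    simp only [mem_ofPred_eq, mem_union]
    constructor
    · intro h
      by_contra hc
      push Not at hc
      exact h (I.2.2 x hc.1 y hc.2)
    · rintro (h | h) h'
      · exact h (I.2.1 le_sup_left h')
      · exact h (I.2.1 le_sup_right h')
  · intro Q hQ _
    have hQ' : (Q ∪ range (fun k : ℕ => ({k} : Set ℕ))).Countable :=
      hQ.union (countable_range _)
    obtain ⟨c, hc⟩ := hQ'.exists_eq_range ⟨{0}, Or.inr ⟨0, rfl⟩⟩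
    let γ : ℕ → {I : Set S // IsLowerSet I ∧ ∀ x ∈ I, ∀ y ∈ I, x ⊔ y ∈ I} := fun k =>
      ⟨{t | ∃ J : Finset ℕ, ∃ hJ : J.Nonempty, (∀ j ∈ J, k ∉ c j) ∧ t ≤ J.sup' hJ s}, by
        rintro a b hab ⟨J, hJ, h1, h2⟩
        exact ⟨J, hJ, h1, hab.trans h2⟩, by
        rintro a ⟨J, hJ, h1, h2⟩ b ⟨J', hJ', h1', h2'⟩
        refine ⟨J ∪ J', hJ.mono Finset.subset_union_left, ?_, ?_⟩
        · intro j hj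
          rcases Finset.mem_union.1 hj with h | h
          · exact h1 j h
          · exact h1' j h
        · rw [Finset.sup'_union hJ hJ']
          exact sup_le_sup h2 h2'⟩
    have mem : ∀ i k, s i ∈ (γ k).1 ↔ k ∉ c i := by
      intro i k
      constructor
      · rintro ⟨J, hJ, h1, h2⟩ h
        exact hs i J hJ (fun hi => h1 i hi h) h2
      · intro h
        exact ⟨{i}, Finset.singleton_nonempty i, by simpa using h, by simp⟩
    refine ⟨γ, ?_, ?_⟩
    · intro k l hkl
      have : ({k} : Set ℕ) ∈ range c := hc ▸ Or.inr ⟨k, rfl⟩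
      obtain ⟨i, hi⟩ := this
      have h1 := mem i k
      have h2 := mem i l
      rw [hkl] at h1
      have h3 := h1.symm.trans h2
      rw [hi] at h3
      simp at h3
      exact h3.symm
    · intro d hd
      have : d ∈ range c := hc ▸ Or.inl hd
      obtain ⟨i, rfl⟩ := this
      refine ⟨_, ⟨s i, rfl⟩, ?_⟩
      ext I
      constructor
      · rintro ⟨h, k, rfl⟩
        refine ⟨k, ?_, rfl⟩
        by_contra hk
        exact h ((mem i k).2 hk)
      · rintro ⟨k, hk, rfl⟩
        exact ⟨fun h => (mem i k).1 h hk, k, rfl⟩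

/-- Refined structure theorem for semilattices of infinite breadth. -/
theorem stmt12 {S : Type u} [SemilatticeSup S]
    (hS : ∀ n : ℕ, ∃ E : Finset S, E.card = n ∧ AIncomp E) :
    (∃ (Ω : Type u) (𝒮 : Set (Set Ω)) (f : S → Set Ω),
        Function.Injective f ∧ (∀ x y : S, f (x ⊔ y) = f x ∪ f y) ∧
        Set.range f = 𝒮 ∧
        ∀ Q : Set (Set ℕ), Q.Countable → UnionClosed Q →
          ∃ γ : ℕ → Ω, Function.Injective γ ∧
            ∀ c ∈ Q, ∃ x ∈ 𝒮, x ∩ Set.range γ = γ '' c) ∨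
    (∀ (Ω : Type v) (𝒮 : Set (Set Ω)) (f : S → Set Ω),
        Function.Injective f → (∀ x y : S, f (x ⊔ y) = f x ∪ f y) →
        Set.range f = 𝒮 →
        ∃ E : ℕ → Set Ω, IsSpread E ∧
          ∃ C : Finset (Set Ω), IsPartitionC C ∧ Colours C E ∧ Decisive 𝒮 C E ∧
            (Tmax E ⊆ proj 𝒮 (sjoin E) ∨ Tmin E ⊆ proj 𝒮 (sjoin E) ∨
              Tort E ⊆ proj 𝒮 (sjoin E))) := by
  by_cases h : ∃ s : ℕ → S, ∀ i, ∀ J : Finset ℕ, ∀ hJ : J.Nonempty, i ∉ J → ¬ s i ≤ J.sup' hJ s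
  · obtain ⟨s, hs⟩ := h
    exact Or.inl (universal_of_indep s hs)
  · right
    rintro Ω 𝒮 f hinj hf rfl
    by_contra hcon
    apply h
    have hT : UnionClosed (range f) := by
      rintro _ ⟨x, rfl⟩ _ ⟨y, rfl⟩
      exact ⟨x ⊔ y, hf x y⟩
    obtain ⟨E, hE⟩ := exists_good_s12 (range f) hT (big_of_breadth hS f hinj hf)
    obtain ⟨s, hs1, hs2⟩ := exists_indep (range f) E hE (by
      intro E hE C h1 h2 h3
      exact hcon ⟨E, hE.1, C, h1, h2, h3, hE.2⟩)
    choose t ht using hs1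
    refine ⟨t, fun i J hJ hi hle => hs2 i J hi ?_⟩
    have := f_mono f hf hle
    rw [map_sup' f hf] at this
    simpa only [ht] using this
end
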